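/- Assume S_{k-1}(X) ≠ P^r and dim G_{h,k}(X) < (k-h)(h+1) + n(k+1). Then dim G_{h-1,k-1}(X) < (k-h)h + nk. In particular dim S_{k-h}(X) < n(k-h+1) + (k-h). -/

import Mathlib

open Submodule

noncomputable section

/-- Polynomial functions on a complex module: the subalgebra of functions generated by
the linear functionals. -/
def PolyFun (W : Type*) [AddCommGroup W] [Module ℂ W] : Subalgebra ℂ (W → ℂ) :=
  Algebra.adjoin ℂ {f : W → ℂ | IsLinearMap ℂ f}

/-- A subset of a complex module is algebraic (Zariski closed) if it is the common zero
set of a family of polynomial functions. -/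
def IsAlgSet {W : Type*} [AddCommGroup W] [Module ℂ W] (X : Set W) : Prop :=
  ∃ S : Set (W → ℂ), S ⊆ (PolyFun W : Set (W → ℂ)) ∧ X = {x | ∀ f ∈ S, f x = 0}

/-- Zariski closure. -/
def zcl {W : Type*} [AddCommGroup W] [Module ℂ W] (A : Set W) : Set W :=
  ⋂₀ {Y | IsAlgSet Y ∧ A ⊆ Y}

/-- Irreducible algebraic set. -/
def IsIrrAlg {W : Type*} [AddCommGroup W] [Module ℂ W] (X : Set W) : Prop :=
  X.Nonempty ∧ IsAlgSet X ∧
    ∀ Y Z : Set W, IsAlgSet Y → IsAlgSet Z → X ⊆ Y ∪ Z → X ⊆ Y ∨ X ⊆ Z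

/-- Dimension of an (affine) algebraic set: the supremum of the lengths of strict chains
of irreducible algebraic subsets contained in it. -/
def adim {W : Type*} [AddCommGroup W] [Module ℂ W] (X : Set W) : ℕ∞ :=
  sSup {d : ℕ∞ | ∃ n : ℕ, d = (n : ℕ∞) ∧
    ∃ c : Fin (n + 1) → Set W, StrictMono c ∧ ∀ i, IsIrrAlg (c i) ∧ c i ⊆ X}

/-- Projective dimension of a cone: one less than the dimension of the affine cone. -/
def pdim {W : Type*} [AddCommGroup W] [Module ℂ W] (X : Set W) : ℕ∞ := adim X - 1

/-- A cone in a complex module (the affine cone of a projective set). -/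
def IsCone {W : Type*} [AddCommGroup W] [Module ℂ W] (X : Set W) : Prop :=
  (0 : W) ∈ X ∧ ∀ (c : ℂ) (x : W), x ∈ X → c • x ∈ X

/-- The affine cone of an integral projective variety: an irreducible algebraic cone,
different from the origin alone. -/
def IsProjVar {W : Type*} [AddCommGroup W] [Module ℂ W] (X : Set W) : Prop :=
  IsAlgSet X ∧ IsCone X ∧ IsIrrAlg X ∧ X ≠ {0}

/-- Non-degenerate: the cone spans the ambient space. -/
def Nondeg {W : Type*} [AddCommGroup W] [Module ℂ W] (X : Set W) : Prop :=
  Submodule.span ℂ X = ⊤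

/-- The projective set is a cone over some vertex: there is a point `v` (vertex) of the
variety such that the variety is a union of lines through the vertex. -/
def IsConeVar {W : Type*} [AddCommGroup W] [Module ℂ W] (X : Set W) : Prop :=
  ∃ v ∈ X, v ≠ 0 ∧ ∀ x ∈ X, ∀ a b : ℂ, a • v + b • x ∈ X

/-- Affine cone of the `k`-th secant variety `S_k(X)`: the Zariski closure of the union
of the linear spans of `k+1` points of `X`. -/
def Sec {W : Type*} [AddCommGroup W] [Module ℂ W] (X : Set W) (k : ℕ) : Set W :=
  zcl (⋃ p ∈ {p : Fin (k + 1) → W | ∀ i, p i ∈ X},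
    (Submodule.span ℂ (Set.range p) : Set W))

/-- Plücker points of the spans of `(k+1)`-tuples of points of `X`: the raw affine cone
over the image of the span map `Φ : X^{k+1} ⇢ G(k,r)` in Plücker coordinates. -/
def GkConePre {W : Type*} [AddCommGroup W] [Module ℂ W] (X : Set W) (k : ℕ) :
    Set (ExteriorAlgebra ℂ W) :=
  {w | ∃ p : Fin (k + 1) → W, (∀ i, p i ∈ X) ∧ w = ExteriorAlgebra.ιMulti ℂ (k + 1) p}

/-- Affine cone over `G_k(X)` (in Plücker coordinates): Zariski closure of the cone over
the image of the span map. -/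
def GkCone {W : Type*} [AddCommGroup W] [Module ℂ W] (X : Set W) (k : ℕ) :
    Set (ExteriorAlgebra ℂ W) :=
  zcl (GkConePre X k)

/-- `G_k(X)` as a set of `(k+1)`-dimensional subspaces (projective `k`-planes): those
whose Plücker point lies in the closure of the image of the span map. -/
def Gk {W : Type*} [AddCommGroup W] [Module ℂ W] (X : Set W) (k : ℕ) :
    Set (Submodule ℂ W) :=
  {U | Module.finrank ℂ U = k + 1 ∧
    ∀ p : Fin (k + 1) → W, (∀ i, p i ∈ U) →
      ExteriorAlgebra.ιMulti ℂ (k + 1) p ∈ GkCone X k}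

/-- Raw cone of Plücker points of `h`-planes contained in some `(k+1)`-secant `k`-plane. -/
def GhkConePre {W : Type*} [AddCommGroup W] [Module ℂ W] (X : Set W) (h k : ℕ) :
    Set (ExteriorAlgebra ℂ W) :=
  {w | ∃ (p : Fin (k + 1) → W) (q : Fin (h + 1) → W), (∀ i, p i ∈ X) ∧
    (∀ j, q j ∈ Submodule.span ℂ (Set.range p)) ∧
    w = ExteriorAlgebra.ιMulti ℂ (h + 1) q}

/-- Affine cone over `G_{h,k}(X)` in Plücker coordinates. -/
def GhkCone {W : Type*} [AddCommGroup W] [Module ℂ W] (X : Set W) (h k : ℕ) :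
    Set (ExteriorAlgebra ℂ W) :=
  zcl (GhkConePre X h k)

theorem ringKrullDim_eq_of_isIntegral {A B : Type*} [CommRing A] [CommRing B] [Algebra A B]
    [Algebra.IsIntegral A B] (hinj : Function.Injective (algebraMap A B)) :
    ringKrullDim B = ringKrullDim A := by
  apply le_antisymm
  · refine Order.krullDim_le_of_strictMono (PrimeSpectrum.comap (algebraMap A B)) ?_
    intro p q hpq
    exact Ideal.IsIntegral.comap_lt_comap (R := A) (I := p.asIdeal) (J := q.asIdeal) hpq
  · refine iSup_le fun l => ?_
    obtain ⟨Q, -, hQ, hQ'⟩ := Ideal.exists_ideal_over_prime_of_isIntegral l.head.asIdeal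
      (⊥ : Ideal B) (by
        rw [← RingHom.ker_eq_comap_bot, (RingHom.injective_iff_ker_eq_bot _).1 hinj]
        exact bot_le)
    have : Q.LiesOver l.head.asIdeal := ⟨hQ'.symm⟩
    obtain ⟨M, hM, -⟩ := Ideal.exists_ltSeries_of_hasGoingUp l Q
    rw [← hM]
    exact Order.LTSeries.length_le_krullDim M

/-- The transcendence degree over `ℂ` of a set of elements of a field. -/
def trd {K : Type*} [Field K] [Algebra ℂ K] (S : Set K) : ℕ∞ :=
  (AlgebraicIndependent.matroid ℂ K).eRk S

/-- The relative algebraic closure of a set of elements. -/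
def acl {K : Type*} [Field K] [Algebra ℂ K] (S : Set K) : Set K :=
  (AlgebraicIndependent.matroid ℂ K).closure S

section trd
variable {K : Type*} [Field K] [Algebra ℂ K] {S T : Set K}

theorem subset_acl (S : Set K) : S ⊆ acl S :=
  (AlgebraicIndependent.matroid ℂ K).subset_closure S (by simp)

theorem acl_mono (h : S ⊆ T) : acl S ⊆ acl T :=
  (AlgebraicIndependent.matroid ℂ K).closure_subset_closure h

theorem acl_acl (S : Set K) : acl (acl S) = acl S :=
  (AlgebraicIndependent.matroid ℂ K).closure_closure S

theorem trd_acl (S : Set K) : trd (acl S) = trd S :=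
  (AlgebraicIndependent.matroid ℂ K).eRk_closure_eq S

theorem trd_mono (h : S ⊆ T) : trd S ≤ trd T :=
  (AlgebraicIndependent.matroid ℂ K).eRk_mono h

theorem trd_le_of_subset_acl (h : S ⊆ acl T) : trd S ≤ trd T :=
  (trd_mono h).trans (trd_acl T).le

theorem acl_subset_acl (h : S ⊆ acl T) : acl S ⊆ acl T :=
  (acl_mono h).trans (acl_acl T).subset

theorem acl_eq (S : Set K) :
    acl S = (Subalgebra.algebraicClosure (Algebra.adjoin ℂ S) K : Set K) :=
  AlgebraicIndependent.matroid_closure_eq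

theorem mem_acl_iff {S : Set K} {x : K} : x ∈ acl S ↔ IsAlgebraic (Algebra.adjoin ℂ S) x := by
  rw [acl_eq]; rfl

/-- The relative algebraic closure as a subfield. -/
def aclField (S : Set K) : IntermediateField ℂ K :=
  Subalgebra.toIntermediateField
    ((Subalgebra.algebraicClosure (Algebra.adjoin ℂ S) K).restrictScalars ℂ)
    (fun _ hx => IsAlgebraic.inv hx)

theorem coe_aclField (S : Set K) : (aclField S : Set K) = acl S := by
  rw [acl_eq]; rfl

theorem adjoin_subset_acl (S : Set K) : (Algebra.adjoin ℂ S : Set K) ⊆ acl S := by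
  rw [← coe_aclField]
  have : Algebra.adjoin ℂ S ≤ (aclField S).toSubalgebra :=
    Algebra.adjoin_le (by
      intro x hx
      have := subset_acl S hx
      rwa [← coe_aclField] at this)
  exact this

theorem trd_le_encard (S : Set K) : trd S ≤ S.encard :=
  (AlgebraicIndependent.matroid ℂ K).eRk_le_encard S

theorem trd_union_le (S T : Set K) : trd (S ∪ T) ≤ trd S + trd T :=
  (AlgebraicIndependent.matroid ℂ K).eRk_union_le_eRk_add_eRk S T

theorem acl_eq_of_trd_le (hS : trd S ≠ ⊤) (h : S ⊆ T) (hr : trd T ≤ trd S) : acl S = acl T :=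
  Matroid.IsRkFinite.closure_eq_closure_of_subset_of_eRk_ge_eRk
    (Matroid.eRk_lt_top_iff.1 (lt_top_iff_ne_top.2 hS)) h hr

theorem ringKrullDim_adjoin_eq_trd (S : Set K) [Algebra.FiniteType ℂ (Algebra.adjoin ℂ S)] :
    ringKrullDim (Algebra.adjoin ℂ S) = (trd S : WithBot ℕ∞) := by
  obtain ⟨s, g, hg, hgi⟩ := exists_integral_inj_algHom_of_fg ℂ (Algebra.adjoin ℂ S)
  let := g.toRingHom.toAlgebra
  have : Algebra.IsIntegral (MvPolynomial (Fin s) ℂ) (Algebra.adjoin ℂ S) := ⟨hgi⟩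
  rw [ringKrullDim_eq_of_isIntegral (A := MvPolynomial (Fin s) ℂ) hg,
    MvPolynomial.ringKrullDim_of_isNoetherianRing, ringKrullDim_eq_zero_of_field, zero_add]
  have e : (Algebra.adjoin ℂ S).val.comp g =
      MvPolynomial.aeval (fun i => (g (MvPolynomial.X i) : K)) := by
    ext i; simp
  have hind : AlgebraicIndependent ℂ (fun i => (g (MvPolynomial.X i) : K)) := by
    rw [AlgebraicIndependent, ← e]
    exact Subtype.val_injective.comp hg
  set T := Set.range (fun i => (g (MvPolynomial.X i) : K)) with hT
  have h1 : T ⊆ acl S := by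
    rintro _ ⟨i, rfl⟩
    exact adjoin_subset_acl S (g (MvPolynomial.X i)).2
  have h2 : S ⊆ acl T := by
    intro x hx
    rw [mem_acl_iff]
    obtain ⟨p, hp, hpx⟩ := hgi (⟨x, Algebra.subset_adjoin hx⟩ : Algebra.adjoin ℂ S)
    let φ : MvPolynomial (Fin s) ℂ →ₐ[ℂ] Algebra.adjoin ℂ T :=
      MvPolynomial.aeval (fun i => (⟨(g (MvPolynomial.X i) : K),
        Algebra.subset_adjoin ⟨i, rfl⟩⟩ : Algebra.adjoin ℂ T))
    have hφ : (Algebra.adjoin ℂ T).val.comp φ = (Algebra.adjoin ℂ S).val.comp g := by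
      ext i; simp [φ]
    refine IsIntegral.isAlgebraic ⟨p.map (φ : MvPolynomial (Fin s) ℂ →+* Algebra.adjoin ℂ T),
      hp.map _, ?_⟩
    have h := congrArg ((Algebra.adjoin ℂ S).val : Algebra.adjoin ℂ S →+* K) hpx
    rw [Polynomial.hom_eval₂] at h
    rw [Polynomial.eval₂_map]
    have h' := congrArg (fun f : MvPolynomial (Fin s) ℂ →ₐ[ℂ] K =>
      Polynomial.eval₂ (f : MvPolynomial (Fin s) ℂ →+* K) x p) hφ
    exact h'.trans (h.trans (map_zero _))
  have h3 : trd S = trd T := le_antisymm (trd_le_of_subset_acl h2) (trd_le_of_subset_acl h1)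
  rw [h3]
  have h4 : trd T = T.encard :=
    (AlgebraicIndependent.matroid_indep_iff.2 hind.to_subtype_range).eRk_eq_encard
  rw [h4, hT, ← Set.image_univ, Set.InjOn.encard_image hind.injective.injOn]
  simp

end trd

section derivation
variable {K : Type*} [Field K] [Algebra ℂ K]

theorem exists_derivation_extending {A : Type*} [CommRing A] [Algebra ℂ A] [Algebra A K]
    [IsScalarTower ℂ A K] [Algebra.FormallyEtale A K] (d : Derivation ℂ A K) :
    ∃ D : Derivation ℂ K K, ∀ x, D (algebraMap A K x) = d x := by
  let e := KaehlerDifferential.tensorKaehlerEquivOfFormallyEtale ℂ A K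
  let f : TensorProduct A K (Ω[A⁄ℂ]) →ₗ[K] K := 
    TensorProduct.AlgebraTensorModule.lift
      ((LinearMap.toSpanSingleton K (Ω[A⁄ℂ] →ₗ[A] K) d.liftKaehlerDifferential))
  refine ⟨(f ∘ₗ e.symm.toLinearMap).compDer (KaehlerDifferential.D ℂ K), fun x => ?_⟩
  have := KaehlerDifferential.tensorKaehlerEquivOfFormallyEtale_symm_D_algebraMap ℂ A K x
  simp [e, f, this]

theorem derivation_eq_zero_of_mem_acl {S : Set K} {y : K} (hy : y ∈ acl S)
    (D : Derivation ℂ K K) (hD : ∀ s ∈ S, D s = 0) : D y = 0 := by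
  let F : IntermediateField ℂ K :=
    { carrier := {x | D x = 0}
      mul_mem' := fun {a b} ha hb => by simp_all
      add_mem' := fun {a b} ha hb => by simp_all
      algebraMap_mem' := fun r => by simp
      inv_mem' := fun x hx => by simp_all [Derivation.leibniz_inv] }
  have hSF : Algebra.adjoin ℂ S ≤ F.toSubalgebra := Algebra.adjoin_le hD
  let D' : Derivation F K K := Derivation.mk'
    { toFun := D
      map_add' := map_add D
      map_smul' := fun c x => by
        have : D (c : K) = 0 := c.2
        simp [Algebra.smul_def, this] } (fun a b => by simp)
  obtain ⟨p, hp, hpy⟩ := mem_acl_iff.1 hy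
  have halg : IsAlgebraic F y := by
    refine ⟨p.map (Subalgebra.inclusion hSF).toRingHom, ?_, ?_⟩
    · exact (Polynomial.map_ne_zero_iff (Subalgebra.inclusion_injective hSF)).2 hp
    · rw [Polynomial.aeval_def, Polynomial.eval₂_map]
      exact hpy
  have hsep : (minpoly F y).Separable := (minpoly.irreducible halg.isIntegral).separable
  have h0 := D'.map_aeval (minpoly F y) y
  rw [minpoly.aeval, map_zero, smul_eq_mul] at h0
  have hne := hsep.aeval_derivative_ne_zero (minpoly.aeval F y)
  exact (mul_eq_zero.1 h0.symm).resolve_left hne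
theorem exists_derivation_of_isTranscendenceBasis {b : Set K}
    (hb : IsTranscendenceBasis ℂ ((↑) : b → K)) (y : b) :
    ∃ D : Derivation ℂ K K, D y = 1 ∧ ∀ z : b, z ≠ y → D z = 0 := by
  classical
  let e := hb.1.aevalEquiv
  let A := Algebra.adjoin ℂ (Set.range ((↑) : b → K))
  let d : Derivation ℂ A K := Derivation.mk'
    (A.val.toLinearMap ∘ₗ e.toLinearMap ∘ₗ (MvPolynomial.pderiv (R := ℂ) y : _ →ₗ[ℂ] _) ∘ₗ
      e.symm.toLinearMap)
    (fun u v => by simp [Algebra.smul_def, mul_comm])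
  have halg : Algebra.IsAlgebraic A K := hb.isAlgebraic
  let : Algebra (FractionRing A) K := FractionRing.liftAlgebra A K
  have : IsScalarTower A (FractionRing A) K := FractionRing.isScalarTower_liftAlgebra A K
  have : Algebra.IsAlgebraic (FractionRing A) K := by
    exact (IsFractionRing.comap_isAlgebraic_iff (A := A) (K := FractionRing A)).1 halg
  have : Algebra.FormallyEtale A (FractionRing A) :=
    Algebra.FormallyEtale.of_isLocalization (nonZeroDivisors A)
  let : Algebra ℚ (FractionRing A) :=
    ((algebraMap ℂ (FractionRing A)).comp (algebraMap ℚ ℂ)).toAlgebra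
  have : CharZero (FractionRing A) := algebraRat.charZero _
  have : Algebra.FormallyEtale (FractionRing A) K := Algebra.FormallyEtale.of_isSeparable _ _
  have : Algebra.FormallyEtale A K := Algebra.FormallyEtale.comp A (FractionRing A) K
  obtain ⟨D, hD⟩ := exists_derivation_extending d
  have key : ∀ z : b, D z = if z = y then 1 else 0 := by
    intro z
    have h1 : e (MvPolynomial.X z) = (⟨z, Algebra.subset_adjoin ⟨z, rfl⟩⟩ : A) := by
      apply Subtype.ext
      simp [e]
    have h2 := hD ⟨z, Algebra.subset_adjoin ⟨z, rfl⟩⟩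
    refine h2.trans ?_
    change algebraMap A K (e (MvPolynomial.pderiv y (e.symm _))) = _
    rw [← h1, AlgEquiv.symm_apply_apply, MvPolynomial.pderiv_X]
    by_cases h : z = y
    · subst h; simp
    · simp [h]
  exact ⟨D, by simp [key], fun z hz => by simp [key, hz]⟩

theorem mem_acl_of_derivation {S : Set K} {y : K}
    (h : ∀ D : Derivation ℂ K K, (∀ s ∈ S, D s = 0) → D y = 0) : y ∈ acl S := by
  by_contra hy
  let M := AlgebraicIndependent.matroid ℂ K
  obtain ⟨I, hI⟩ := M.exists_isBasis S (by simp [M])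
  have hcl : M.closure I = M.closure S := hI.closure_eq_closure
  have hins : M.Indep (insert y I) := by
    rw [hI.indep.insert_indep_iff]
    left
    exact ⟨by simp [M], by rw [hcl]; exact hy⟩
  obtain ⟨b, hb, hIb⟩ := hins.exists_isBase_superset
  obtain ⟨D, hD1, hD0⟩ := exists_derivation_of_isTranscendenceBasis
    (AlgebraicIndependent.matroid_isBase_iff.1 hb) ⟨y, hIb (by simp)⟩
  have hDI : ∀ s ∈ I, D s = 0 := by
    intro s hs
    refine hD0 ⟨s, hIb (by simp [hs])⟩ fun hsy => hy ?_
    have : s = y := congrArg Subtype.val hsy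
    exact this ▸ subset_acl S (hI.subset hs)
  have := h D (fun s hs => derivation_eq_zero_of_mem_acl (S := I)
    (by show s ∈ M.closure I; rw [hcl]; exact subset_acl S hs) D hDI)
  exact one_ne_zero (hD1.symm.trans this)

end derivation

section polyfun
variable {W : Type*} [AddCommGroup W] [Module ℂ W]

theorem linear_mem_polyFun (l : W →ₗ[ℂ] ℂ) : (fun w => l w) ∈ PolyFun W :=
  Algebra.subset_adjoin l.isLinear

theorem polyFun_comp_mem {T : Type*} (R : Subalgebra ℂ (T → ℂ)) (φ : T → W)
    (hφ : ∀ l : W →ₗ[ℂ] ℂ, (fun t => l (φ t)) ∈ R) {f : W → ℂ} (hf : f ∈ PolyFun W) :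
    (fun t => f (φ t)) ∈ R := by
  induction hf using Algebra.adjoin_induction with
  | mem f hf => exact hφ (IsLinearMap.mk' f hf)
  | algebraMap r => exact R.algebraMap_mem r
  | add f g _ _ hf hg => exact R.add_mem hf hg
  | mul f g _ _ hf hg => exact R.mul_mem hf hg

/-- A set on which a product of polynomial functions vanishes only if one of the factors
does. -/
def Irr (X : Set W) : Prop :=
  X.Nonempty ∧ ∀ f ∈ PolyFun W, ∀ g ∈ PolyFun W, (∀ x ∈ X, f x * g x = 0) →
    (∀ x ∈ X, f x = 0) ∨ (∀ x ∈ X, g x = 0)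

theorem isAlgSet_singleton_zero {f : W → ℂ} (hf : f ∈ PolyFun W) :
    IsAlgSet {x | f x = 0} := ⟨{f}, by simpa using hf, by simp⟩

theorem IsIrrAlg.irr {X : Set W} (h : IsIrrAlg X) : Irr X := by
  refine ⟨h.1, fun f hf g hg hfg => ?_⟩
  exact h.2.2 _ _ (isAlgSet_singleton_zero hf) (isAlgSet_singleton_zero hg)
    fun x hx => mul_eq_zero.1 (hfg x hx)

theorem Irr.isIrrAlg {X : Set W} (h : Irr X) (hX : IsAlgSet X) : IsIrrAlg X := by
  refine ⟨h.1, hX, ?_⟩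
  rintro _ _ ⟨S, hS, rfl⟩ ⟨S', hS', rfl⟩ hsub
  by_contra! hcon
  obtain ⟨h1, h2⟩ := hcon
  simp only [Set.not_subset, Set.mem_ofPred_eq, not_forall] at h1 h2
  obtain ⟨x, hx, f, hf, hfx⟩ := h1
  obtain ⟨y, hy, g, hg, hgy⟩ := h2
  rcases h.2 f (hS hf) g (hS' hg) (fun z hz => by
    rcases hsub hz with h | h
    · simp [h f hf]
    · simp [h g hg]) with h | h
  · exact hfx (h x hx)
  · exact hgy (h y hy)

theorem subset_zcl (X : Set W) : X ⊆ zcl X := fun _ hx _ hY => hY.2 hx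

theorem zcl_minimal {X Y : Set W} (hY : IsAlgSet Y) (h : X ⊆ Y) : zcl X ⊆ Y :=
  fun _ hx => hx Y ⟨hY, h⟩

theorem mem_zcl_iff {X : Set W} {w : W} :
    w ∈ zcl X ↔ ∀ f ∈ PolyFun W, (∀ x ∈ X, f x = 0) → f w = 0 := by
  constructor
  · intro hw f hf hX
    exact hw _ ⟨isAlgSet_singleton_zero hf, hX⟩
  · rintro h _ ⟨⟨S, hS, rfl⟩, hXY⟩
    exact fun f hf => h f (hS hf) fun x hx => hXY hx f hf

theorem zcl_eq_zcl {X Y : Set W}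
    (h : ∀ f ∈ PolyFun W, (∀ x ∈ X, f x = 0) ↔ (∀ x ∈ Y, f x = 0)) : zcl X = zcl Y := by
  ext w
  rw [mem_zcl_iff, mem_zcl_iff]
  exact ⟨fun H f hf hY => H f hf ((h f hf).2 hY), fun H f hf hX => H f hf ((h f hf).1 hX)⟩

theorem isAlgSet_zcl (X : Set W) : IsAlgSet (zcl X) :=
  ⟨{f | f ∈ PolyFun W ∧ ∀ x ∈ X, f x = 0}, fun _ h => h.1, by
    ext w; rw [mem_zcl_iff]; exact ⟨fun h f hf => h f hf.1 hf.2, fun h f hf hX => h f ⟨hf, hX⟩⟩⟩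

theorem zcl_eq_self {X : Set W} (h : IsAlgSet X) : zcl X = X :=
  (zcl_minimal h subset_rfl).antisymm (subset_zcl X)

theorem zcl_mono {X Y : Set W} (h : X ⊆ Y) : zcl X ⊆ zcl Y :=
  zcl_minimal (isAlgSet_zcl Y) (h.trans (subset_zcl Y))

/-- Polynomial functions from polynomials in the coordinates of a basis. -/
def polyOfBasis {ι : Type*} [Finite ι] (b : Module.Basis ι ℂ W) :
    MvPolynomial ι ℂ →ₐ[ℂ] PolyFun W :=
  MvPolynomial.aeval fun i => ⟨fun w => b.coord i w, linear_mem_polyFun _⟩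

theorem polyOfBasis_apply {ι : Type*} [Finite ι] (b : Module.Basis ι ℂ W) (p : MvPolynomial ι ℂ)
    (w : W) : (polyOfBasis b p : W → ℂ) w = MvPolynomial.eval (fun i => b.coord i w) p := by
  induction p using MvPolynomial.induction_on with
  | C a => simp [polyOfBasis]
  | add p q hp hq => simp [hp, hq]
  | mul_X p i hp => 
    rw [map_mul, map_mul, ← hp]
    simp [polyOfBasis]

theorem polyOfBasis_surjective {ι : Type*} [Finite ι] (b : Module.Basis ι ℂ W) :
    Function.Surjective (polyOfBasis b) := by
  have := Fintype.ofFinite ι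
  have : ∀ f ∈ PolyFun W, ∃ p, (polyOfBasis b p : W → ℂ) = f := by
    intro f hf
    induction hf using Algebra.adjoin_induction with
    | mem f hf =>
      refine ⟨∑ i, MvPolynomial.C (f (b i)) * MvPolynomial.X i, ?_⟩
      ext w
      rw [polyOfBasis_apply]
      simp only [map_sum, map_mul, MvPolynomial.eval_C, MvPolynomial.eval_X]
      have h : (IsLinearMap.mk' f hf) w = (IsLinearMap.mk' f hf) (∑ i, b.repr w i • b i) := by
        rw [b.sum_repr]
      refine Eq.trans ?_ h.symm
      rw [map_sum]
      simp [mul_comm]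
    | algebraMap r => exact ⟨algebraMap ℂ _ r, by simp⟩
    | add f g _ _ hf hg =>
      obtain ⟨⟨p, rfl⟩, ⟨q, rfl⟩⟩ := hf, hg
      exact ⟨p + q, by simp⟩
    | mul f g _ _ hf hg =>
      obtain ⟨⟨p, rfl⟩, ⟨q, rfl⟩⟩ := hf, hg
      exact ⟨p * q, by simp⟩
  rintro ⟨f, hf⟩
  obtain ⟨p, hp⟩ := this f hf
  exact ⟨p, Subtype.ext hp⟩

instance [FiniteDimensional ℂ W] : Algebra.FiniteType ℂ (PolyFun W) :=
  Algebra.FiniteType.of_surjective _ (polyOfBasis_surjective (Module.finBasis ℂ W))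

theorem mem_of_vanish [FiniteDimensional ℂ W] (P : Ideal (PolyFun W)) [P.IsPrime] (f : PolyFun W)
    (h : ∀ w, (∀ g ∈ P, (g : W → ℂ) w = 0) → (f : W → ℂ) w = 0) : f ∈ P := by
  let b := Module.finBasis ℂ W
  obtain ⟨p, rfl⟩ := polyOfBasis_surjective b f
  have hP := MvPolynomial.IsPrime.vanishingIdeal_zeroLocus (k := ℂ) (K := ℂ)
    (P.comap (polyOfBasis b))
  change p ∈ P.comap (polyOfBasis b)
  rw [← hP, MvPolynomial.mem_vanishingIdeal_iff]
  intro x hx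
  rw [MvPolynomial.mem_zeroLocus_iff] at hx
  have hxb : (fun i => b.coord i (b.equivFun.symm x)) = x := by
    ext i
    exact congrFun (b.equivFun.apply_symm_apply x) i
  have := h (b.equivFun.symm x) (fun g hg => by
    obtain ⟨q, rfl⟩ := polyOfBasis_surjective b g
    rw [polyOfBasis_apply, hxb]
    simpa using hx q hg)
  rw [polyOfBasis_apply, hxb] at this
  simpa using this

end polyfun

section dimension
variable {W : Type*} [AddCommGroup W] [Module ℂ W]

/-- The common zeros of an ideal of polynomial functions. -/
def zeros (P : Ideal (PolyFun W)) : Set W := {w | ∀ g ∈ P, (g : W → ℂ) w = 0}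

theorem isAlgSet_zeros (P : Ideal (PolyFun W)) : IsAlgSet (zeros P) :=
  ⟨(fun g : PolyFun W => (g : W → ℂ)) '' P, by rintro _ ⟨g, -, rfl⟩; exact g.2, by
    ext w; simp [zeros]⟩

theorem zeros_anti {P Q : Ideal (PolyFun W)} (h : P ≤ Q) : zeros Q ⊆ zeros P :=
  fun _ hw g hg => hw g (h hg)

/-- The ideal of polynomial functions vanishing on a set. -/
def vanish (X : Set W) : Ideal (PolyFun W) where
  carrier := {g | ∀ x ∈ X, (g : W → ℂ) x = 0}
  add_mem' ha hb x hx := by simp [ha x hx, hb x hx]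
  zero_mem' x _ := rfl
  smul_mem' c g hg x hx := by simp [hg x hx]

theorem vanish_anti {X Y : Set W} (h : X ⊆ Y) : vanish Y ≤ vanish X :=
  fun _ hg x hx => hg x (h hx)

theorem Irr.isPrime_vanish {X : Set W} (h : Irr X) : (vanish X).IsPrime where
  ne_top' := fun htop => by
    obtain ⟨x, hx⟩ := h.1
    have : (1 : PolyFun W) ∈ vanish X := htop ▸ Submodule.mem_top
    exact one_ne_zero (α := ℂ) (this x hx)
  mem_or_mem' {f g} hfg := h.2 f f.2 g g.2 hfg

theorem zeros_vanish {X : Set W} (h : IsAlgSet X) : zeros (vanish X) = X := by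
  rw [← zcl_eq_self h]
  ext w
  rw [mem_zcl_iff, zcl_eq_self h]
  exact ⟨fun H f hf hX => H ⟨f, hf⟩ hX, fun H g hg => H g g.2 hg⟩

theorem vanish_zeros [FiniteDimensional ℂ W] (P : Ideal (PolyFun W)) [P.IsPrime] :
    vanish (zeros P) = P :=
  le_antisymm (fun f hf => mem_of_vanish P f hf) fun _ hf _ hw => hw _ hf

theorem isIrrAlg_zeros [FiniteDimensional ℂ W] (P : Ideal (PolyFun W)) [hP : P.IsPrime] :
    IsIrrAlg (zeros P) := by
  refine Irr.isIrrAlg ⟨?_, fun f hf g hg hfg => ?_⟩ (isAlgSet_zeros P)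
  · by_contra hne
    rw [Set.not_nonempty_iff_eq_empty] at hne
    refine hP.ne_top ((Ideal.eq_top_iff_one _).2 ?_)
    rw [← vanish_zeros P, hne]
    exact fun x hx => hx.elim
  · have h : (⟨f, hf⟩ * ⟨g, hg⟩ : PolyFun W) ∈ vanish (zeros P) := hfg
    rw [vanish_zeros] at h
    rcases hP.mem_or_mem h with h | h
    · exact Or.inl fun x hx => hx _ h
    · exact Or.inr fun x hx => hx _ h

theorem length_le_adim {X : Set W} {n : ℕ} (c : Fin (n + 1) → Set W) (hc : StrictMono c)
    (hX : ∀ i, IsIrrAlg (c i) ∧ c i ⊆ X) : (n : ℕ∞) ≤ adim X :=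
  le_sSup ⟨n, rfl, c, hc, hX⟩

theorem adim_mono {X Y : Set W} (h : X ⊆ Y) : adim X ≤ adim Y :=
  sSup_le_sSup fun _ ⟨n, hd, c, hc, hX⟩ => ⟨n, hd, c, hc, fun i => ⟨(hX i).1, (hX i).2.trans h⟩⟩

variable {T : Type*} {K : Type*} [Field K] [Algebra ℂ K]

/-- The dimension of the closure of the image of a parametrization is the transcendence degree
of its coordinates. -/
theorem adim_zcl_range [FiniteDimensional ℂ W] (R : Subalgebra ℂ (T → ℂ)) (j : R →ₐ[ℂ] K)
    (hj : Function.Injective j) (φ : T → W)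
    (hφ : ∀ l : W →ₗ[ℂ] ℂ, (fun t => l (φ t)) ∈ R) :
    adim (zcl (Set.range φ)) = trd (Set.range fun l : W →ₗ[ℂ] ℂ => j ⟨_, hφ l⟩) := by
  set S := Set.range fun l : W →ₗ[ℂ] ℂ => j ⟨_, hφ l⟩ with hS
  let c : PolyFun W →ₐ[ℂ] R :=
    { toFun := fun f => ⟨fun t => (f : W → ℂ) (φ t), polyFun_comp_mem R φ hφ f.2⟩
      map_one' := rfl
      map_mul' := fun _ _ => rfl
      map_zero' := rfl
      map_add' := fun _ _ => rfl
      commutes' := fun _ => rfl }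
  let ψ : PolyFun W →ₐ[ℂ] K := j.comp c
  have hker : ∀ f : PolyFun W, ψ f = 0 ↔ ∀ t, (f : W → ℂ) (φ t) = 0 := by
    intro f
    have : ψ f = 0 ↔ c f = 0 := map_eq_zero_iff j hj
    rw [this, Subtype.ext_iff, funext_iff]
    rfl
  have hadj : Algebra.adjoin ℂ S = ψ.range := by
    apply le_antisymm
    · refine Algebra.adjoin_le ?_
      rintro _ ⟨l, rfl⟩
      exact ⟨⟨_, linear_mem_polyFun l⟩, rfl⟩
    · rintro _ ⟨⟨f, hf⟩, rfl⟩
      have : (⟨f, hf⟩ : PolyFun W) ∈ (Algebra.adjoin ℂ S).comap ψ := by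
        have key : ∀ f (hf : f ∈ PolyFun W),
            (⟨f, hf⟩ : PolyFun W) ∈ (Algebra.adjoin ℂ S).comap ψ := by
          intro f hf
          induction hf using Algebra.adjoin_induction with
          | mem f hf =>
            exact Algebra.subset_adjoin ⟨IsLinearMap.mk' f hf, rfl⟩
          | algebraMap r => exact Subalgebra.algebraMap_mem ((Algebra.adjoin ℂ S).comap ψ) r
          | add f g _ _ hf hg => exact add_mem hf hg
          | mul f g _ _ hf hg => exact mul_mem hf hg
        exact key f hf
      exact this
  let B := ψ.range
  let ρ : PolyFun W →+* B := ψ.rangeRestrict.toRingHom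
  have hρ : Function.Surjective ρ := ψ.rangeRestrict_surjective
  have hρ0 : ∀ f, ρ f = 0 ↔ ψ f = 0 := fun f => Subtype.ext_iff
  have : Algebra.FiniteType ℂ B :=
    Algebra.FiniteType.of_surjective ψ.rangeRestrict ψ.rangeRestrict_surjective
  have hdim : ringKrullDim B = (trd S : WithBot ℕ∞) := by
    have : Algebra.FiniteType ℂ (Algebra.adjoin ℂ S) := by rw [hadj]; exact this
    rw [← ringKrullDim_adjoin_eq_trd S, hadj]
  apply le_antisymm
  · refine sSup_le ?_
    rintro _ ⟨n, rfl, c, hc, hX⟩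
    rw [← WithBot.coe_le_coe, ← hdim]
    have hk : ∀ i, RingHom.ker ρ ≤ vanish (c i) := by
      intro i f hf x hx
      have h1 := (hker f).1 ((hρ0 f).1 hf)
      refine mem_zcl_iff.1 ((hX i).2 hx) f f.2 ?_
      rintro _ ⟨t, rfl⟩
      exact h1 t
    let p : Fin (n + 1) → PrimeSpectrum B := fun i =>
      ⟨(vanish (c i.rev)).map ρ, by
        have := ((hX i.rev).1.irr).isPrime_vanish
        exact Ideal.map_isPrime_of_surjective hρ (hk _)⟩
    have hcomap : ∀ i, ((vanish (c i)).map ρ).comap ρ = vanish (c i) := fun i => by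
      rw [Ideal.comap_map_of_surjective' ρ hρ, sup_eq_left]
      exact hk i
    have hp : StrictMono p := by
      intro i i' hii
      have h1 : c i'.rev < c i.rev := hc (Fin.rev_lt_rev.2 hii)
      refine lt_of_le_of_ne (Ideal.map_mono (vanish_anti h1.le)) fun he => ?_
      have h2 : (vanish (c i.rev)).map ρ = (vanish (c i'.rev)).map ρ :=
        congrArg PrimeSpectrum.asIdeal he
      have h3 : vanish (c i.rev) = vanish (c i'.rev) := by
        rw [← hcomap i.rev, h2, hcomap]
      have h4 : c i.rev = c i'.rev := by
        rw [← zeros_vanish (hX i.rev).1.2.1, h3, zeros_vanish (hX i'.rev).1.2.1]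
      exact h1.ne h4.symm
    exact Order.LTSeries.length_le_krullDim (LTSeries.mk n p hp)
  · rw [← WithBot.coe_le_coe, ← hdim]
    refine iSup_le fun l => ?_
    refine WithBot.coe_le_coe.2 (length_le_adim (fun i => zeros ((l i.rev).asIdeal.comap ρ)) ?_ ?_)
    · intro i i' hii
      have h1 : l i'.rev < l i.rev := l.strictMono (Fin.rev_lt_rev.2 hii)
      have h2 : (l i'.rev).asIdeal.comap ρ ≤ (l i.rev).asIdeal.comap ρ := Ideal.comap_mono h1.le
      refine lt_of_le_of_ne (zeros_anti h2) fun he => h1.ne ?_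
      have h3 : (l i.rev).asIdeal.comap ρ = (l i'.rev).asIdeal.comap ρ := by
        have he' : zeros ((l i.rev).asIdeal.comap ρ) = zeros ((l i'.rev).asIdeal.comap ρ) := he
        rw [← vanish_zeros ((l i.rev).asIdeal.comap ρ), he', vanish_zeros]
      exact PrimeSpectrum.ext (Ideal.comap_injective_of_surjective ρ hρ h3.symm)
    · intro i
      refine ⟨isIrrAlg_zeros _, fun w hw => mem_zcl_iff.2 fun f hf hz => ?_⟩
      refine hw ⟨f, hf⟩ ?_
      have h1 : ρ ⟨f, hf⟩ = 0 := (hρ0 _).2 ((hker _).2 fun t => hz _ ⟨t, rfl⟩)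
      rw [Ideal.mem_comap, h1]
      exact zero_mem _

end dimension

section functionrings
variable {T T₁ T₂ : Type*}

/-- A ring of functions without zero divisors: nonzero functions have a common point of
nonvanishing. -/
def IsDom (R : Subalgebra ℂ (T → ℂ)) : Prop :=
  ∀ f ∈ R, ∀ g ∈ R, (∃ x, f x ≠ 0) → (∃ x, g x ≠ 0) → ∃ x, f x ≠ 0 ∧ g x ≠ 0

theorem IsDom.isDomain [Nonempty T] {R : Subalgebra ℂ (T → ℂ)} (hR : IsDom R) : IsDomain R := by
  have : NoZeroDivisors R := ⟨by
    rintro ⟨f, hf⟩ ⟨g, hg⟩ hfg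
    by_contra! hne
    obtain ⟨hf0, hg0⟩ := hne
    have h1 : ∃ x, f x ≠ 0 := by
      by_contra! h; exact hf0 (Subtype.ext (funext h))
    have h2 : ∃ x, g x ≠ 0 := by
      by_contra! h; exact hg0 (Subtype.ext (funext h))
    obtain ⟨x, hx1, hx2⟩ := hR f hf g hg h1 h2
    have := congrFun (congrArg Subtype.val hfg) x
    exact mul_ne_zero hx1 hx2 this⟩
  exact NoZeroDivisors.to_isDomain R

/-- Functions on a power all of whose slices lie in a given ring. -/
def piRing (R : Subalgebra ℂ (T → ℂ)) (I : Type*) [DecidableEq I] :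
    Subalgebra ℂ ((I → T) → ℂ) where
  carrier := {f | ∀ v i, (fun x => f (Function.update v i x)) ∈ R}
  mul_mem' hf hg v i := R.mul_mem (hf v i) (hg v i)
  add_mem' hf hg v i := R.add_mem (hf v i) (hg v i)
  algebraMap_mem' c _ _ := R.algebraMap_mem c

theorem piRing_isDom {R : Subalgebra ℂ (T → ℂ)} (hR : IsDom R) (I : Type*) [DecidableEq I]
    [Finite I] : IsDom (piRing R I) := by
  have := Fintype.ofFinite I
  intro f hf g hg hf0 hg0
  have key : ∀ A : Finset I, ∃ u w, f u ≠ 0 ∧ g w ≠ 0 ∧ ∀ i ∈ A, u i = w i := by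
    intro A
    induction A using Finset.induction_on with
    | empty => exact ⟨hf0.choose, hg0.choose, hf0.choose_spec, hg0.choose_spec, by simp⟩
    | insert i A hi ih =>
      obtain ⟨u, w, hu, hw, huw⟩ := ih
      obtain ⟨x, hx1, hx2⟩ := hR _ (hf u i) _ (hg w i) ⟨u i, by simpa using hu⟩
        ⟨w i, by simpa using hw⟩
      refine ⟨_, _, hx1, hx2, fun k hk => ?_⟩
      rcases eq_or_ne k i with rfl | hki
      · simp
      · simp [hki, huw k (Finset.mem_of_mem_insert_of_ne hk hki)]
  obtain ⟨u, w, hu, hw, huw⟩ := key Finset.univ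
  obtain rfl : u = w := funext fun i => huw i (Finset.mem_univ i)
  exact ⟨u, hu, hw⟩

/-- A function on a power vanishes if it vanishes on a product of dense subsets. -/
theorem piRing_eq_zero {R : Subalgebra ℂ (T → ℂ)} {I : Type*} [DecidableEq I] [Finite I]
    {Z : Set T} (hZ : ∀ f ∈ R, (∀ z ∈ Z, f z = 0) → ∀ x, f x = 0)
    {f : (I → T) → ℂ} (hf : f ∈ piRing R I) (h0 : ∀ v, (∀ i, v i ∈ Z) → f v = 0) (v : I → T) :
    f v = 0 := by
  have := Fintype.ofFinite I
  have key : ∀ A : Finset I, ∀ v, (∀ i ∉ A, v i ∈ Z) → f v = 0 := by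
    intro A
    induction A using Finset.induction_on with
    | empty => exact fun v hv => h0 v fun i => hv i (by simp)
    | insert i A hi ih =>
      intro v hv
      have h := hZ _ (hf v i) (fun z hz => ih _ fun k hk => by
        rcases eq_or_ne k i with rfl | hki
        · simpa using hz
        · simpa [hki] using hv k (by simp [hki, hk])) (v i)
      simpa using h
  exact key Finset.univ v (by simp)

/-- Functions on a product all of whose slices lie in given rings. -/
def prodRing (R₁ : Subalgebra ℂ (T₁ → ℂ)) (R₂ : Subalgebra ℂ (T₂ → ℂ)) :
    Subalgebra ℂ (T₁ × T₂ → ℂ) where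
  carrier := {f | (∀ y, (fun x => f (x, y)) ∈ R₁) ∧ ∀ x, (fun y => f (x, y)) ∈ R₂}
  mul_mem' hf hg := ⟨fun y => R₁.mul_mem (hf.1 y) (hg.1 y), fun y => R₂.mul_mem (hf.2 y) (hg.2 y)⟩
  add_mem' hf hg := ⟨fun y => R₁.add_mem (hf.1 y) (hg.1 y), fun y => R₂.add_mem (hf.2 y) (hg.2 y)⟩
  algebraMap_mem' c := ⟨fun _ => R₁.algebraMap_mem c, fun _ => R₂.algebraMap_mem c⟩

theorem prodRing_isDom {R₁ : Subalgebra ℂ (T₁ → ℂ)} {R₂ : Subalgebra ℂ (T₂ → ℂ)}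
    (h₁ : IsDom R₁) (h₂ : IsDom R₂) : IsDom (prodRing R₁ R₂) := by
  rintro f hf g hg ⟨⟨x, y⟩, hxy⟩ ⟨⟨x', y'⟩, hxy'⟩
  obtain ⟨u, hu, hu'⟩ := h₁ _ (hf.1 y) _ (hg.1 y') ⟨x, hxy⟩ ⟨x', hxy'⟩
  obtain ⟨w, hw, hw'⟩ := h₂ _ (hf.2 u) _ (hg.2 u) ⟨y, hu⟩ ⟨y', hu'⟩
  exact ⟨(u, w), hw, hw'⟩

/-- Polynomial functions of one variable. -/
def lineRing : Subalgebra ℂ (ℂ → ℂ) where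
  carrier := {f | ∃ p : Polynomial ℂ, ∀ t, f t = p.eval t}
  mul_mem' := by rintro f g ⟨p, hp⟩ ⟨q, hq⟩; exact ⟨p * q, fun t => by simp [hp, hq]⟩
  add_mem' := by rintro f g ⟨p, hp⟩ ⟨q, hq⟩; exact ⟨p + q, fun t => by simp [hp, hq]⟩
  algebraMap_mem' c := ⟨Polynomial.C c, fun t => by simp⟩

theorem lineRing_isDom : IsDom lineRing := by
  rintro f ⟨p, hp⟩ g ⟨q, hq⟩ ⟨x, hx⟩ ⟨y, hy⟩
  have hp0 : p ≠ 0 := by rintro rfl; exact hx (by simp [hp])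
  have hq0 : q ≠ 0 := by rintro rfl; exact hy (by simp [hq])
  by_contra! h
  refine mul_ne_zero hp0 hq0 (Polynomial.funext fun t => ?_)
  by_cases ht : p.eval t = 0
  · simp [ht]
  · have := h t (by rwa [hp])
    rw [hq] at this
    simp [this]

theorem id_mem_lineRing : (fun t => t) ∈ lineRing := ⟨Polynomial.X, fun t => by simp⟩

variable {W : Type*} [AddCommGroup W] [Module ℂ W]

/-- Polynomial functions on a subset of a vector space. -/
def resRing (X : Set W) : Subalgebra ℂ (X → ℂ) where
  carrier := {f | ∃ g ∈ PolyFun W, ∀ x : X, f x = g x}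
  mul_mem' := by
    rintro f g ⟨p, hp, hfp⟩ ⟨q, hq, hgq⟩; exact ⟨p * q, mul_mem hp hq, fun t => by simp [hfp, hgq]⟩
  add_mem' := by
    rintro f g ⟨p, hp, hfp⟩ ⟨q, hq, hgq⟩; exact ⟨p + q, add_mem hp hq, fun t => by simp [hfp, hgq]⟩
  algebraMap_mem' c := ⟨_, (PolyFun W).algebraMap_mem c, fun t => rfl⟩

theorem linear_mem_resRing (X : Set W) (l : W →ₗ[ℂ] ℂ) : (fun x : X => l x) ∈ resRing X :=
  ⟨_, linear_mem_polyFun l, fun _ => rfl⟩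

theorem resRing_isDom {X : Set W} (hX : Irr X) : IsDom (resRing X) := by
  rintro f ⟨p, hp, hfp⟩ g ⟨q, hq, hgq⟩ ⟨x, hx⟩ ⟨y, hy⟩
  by_contra! h
  rcases hX.2 p hp q hq (fun z hz => by
    by_cases hz0 : p z = 0
    · simp [hz0]
    · have := h ⟨z, hz⟩ (by rwa [hfp])
      rw [hgq] at this
      simp [this]) with h | h
  · exact hx (by rw [hfp, h x x.2])
  · exact hy (by rw [hgq, h y y.2])

end functionrings

section independence
variable {T : Type*} {R : Subalgebra ℂ (T → ℂ)} {K : Type*} [Field K] [Algebra ℂ K]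

theorem aeval_apply_eq_eval {ι : Type*} (g : ι → R) (F : MvPolynomial ι ℂ) (e : T) :
    (MvPolynomial.aeval g F : T → ℂ) e = MvPolynomial.eval (fun i => (g i : T → ℂ) e) F := by
  induction F using MvPolynomial.induction_on with
  | C a => simp
  | add p q hp hq => simp [hp, hq]
  | mul_X p i hp => simp [hp]

theorem algebraicIndependent_iff_functions (j : R →ₐ[ℂ] K) (hj : Function.Injective j)
    {ι : Type*} (g : ι → R) : AlgebraicIndependent ℂ (fun i => j (g i)) ↔
      ∀ F : MvPolynomial ι ℂ, (∀ e, MvPolynomial.eval (fun i => (g i : T → ℂ) e) F = 0) → F = 0 := by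
  have key : ∀ F : MvPolynomial ι ℂ, MvPolynomial.aeval (fun i => j (g i)) F = 0 ↔
      ∀ e, MvPolynomial.eval (fun i => (g i : T → ℂ) e) F = 0 := by
    intro F
    rw [← MvPolynomial.comp_aeval_apply (f := g) j F, map_eq_zero_iff j hj,
      Subtype.ext_iff, funext_iff]
    refine forall_congr' fun e => ?_
    rw [aeval_apply_eq_eval]; rfl
  rw [algebraicIndependent_iff]
  exact forall_congr' fun F => by rw [key]

theorem card_le_trd {ι : Type*} [Fintype ι] {x : ι → K} (hx : AlgebraicIndependent ℂ x) {S : Set K}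
    (h : ∀ i, x i ∈ acl S) : (Fintype.card ι : ℕ∞) ≤ trd S := by
  have h1 : trd (Set.range x) = (Set.range x).encard :=
    (AlgebraicIndependent.matroid_indep_iff.2 hx.to_subtype_range).eRk_eq_encard
  have h2 : trd (Set.range x) ≤ trd S := trd_le_of_subset_acl (by rintro _ ⟨i, rfl⟩; exact h i)
  rw [h1, ← Set.image_univ, Set.InjOn.encard_image hx.injective.injOn] at h2
  simpa using h2

theorem exists_algebraicIndependent_of_trd {ι : Type*} (x : ι → K) {N : ℕ}
    (h : trd (Set.range x) = N) : ∃ i : Fin N → ι, AlgebraicIndependent ℂ (fun k => x (i k)) := by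
  obtain ⟨I, hI⟩ := (AlgebraicIndependent.matroid ℂ K).exists_isBasis (Set.range x) (by simp)
  have hc : I.encard = N := by rw [hI.encard_eq_eRk]; exact h
  have hfin : I.Finite := Set.finite_of_encard_eq_coe hc
  have := hfin.fintype
  have hcard : Fintype.card I = N := by
    rw [← Set.coe_fintypeCard] at hc; exact_mod_cast hc
  let e := (Fintype.equivFinOfCardEq hcard).symm
  choose i hi using fun k : Fin N => hI.subset (e k).2
  refine ⟨i, ?_⟩
  have h1 := AlgebraicIndependent.matroid_indep_iff.1 hI.indep
  have h2 := AlgebraicIndependent.comp h1 e e.injective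
  convert h2 using 2 with k
  simp [hi]

end independence

section parameters
variable {δ : Type*} (X : Set (δ → ℂ)) {I : Type*} [DecidableEq I]

/-- Polynomial functions on families of points of `X` and scalars. -/
def parRing (I : Type*) [DecidableEq I] : Subalgebra ℂ ((I → X × ℂ) → ℂ) :=
  piRing (prodRing (resRing X) lineRing) I

variable {X}

theorem parRing_isDom [Finite I] (hX : Irr X) : IsDom (parRing X I) :=
  piRing_isDom (prodRing_isDom (resRing_isDom hX) lineRing_isDom) I

theorem comp_apply_mem_piRing {T : Type*} {R : Subalgebra ℂ (T → ℂ)} {f : T → ℂ} (hf : f ∈ R)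
    (i : I) : (fun e : I → T => f (e i)) ∈ piRing R I := by
  intro v k
  rcases eq_or_ne k i with rfl | hki
  · simpa using hf
  · simp only [Function.update_of_ne hki.symm]
    exact R.algebraMap_mem (f (v i))

/-- The value of a linear functional at a point of a family. -/
def pt (X : Set (δ → ℂ)) (i : I) (l : (δ → ℂ) →ₗ[ℂ] ℂ) : parRing X I :=
  ⟨fun e => l (e i).1, comp_apply_mem_piRing (R := prodRing (resRing X) lineRing)
    (f := fun z : X × ℂ => l z.1)
    ⟨fun _ => linear_mem_resRing X l, fun x => lineRing.algebraMap_mem (l x)⟩ i⟩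

/-- A scalar of a family. -/
def sc (X : Set (δ → ℂ)) (i : I) : parRing X I :=
  ⟨fun e => (e i).2, comp_apply_mem_piRing (R := prodRing (resRing X) lineRing)
    (f := fun z : X × ℂ => z.2)
    ⟨fun y => (resRing X).algebraMap_mem y, fun _ => id_mem_lineRing⟩ i⟩

@[simp] theorem pt_apply (i : I) (l : (δ → ℂ) →ₗ[ℂ] ℂ) (e : I → X × ℂ) :
    (pt X i l : (I → X × ℂ) → ℂ) e = l (e i).1 := rfl

@[simp] theorem sc_apply (i : I) (e : I → X × ℂ) :
    (sc X i : (I → X × ℂ) → ℂ) e = (e i).2 := rfl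

theorem exists_independent_functionals [Finite δ] (hX : IsIrrAlg X) {N : ℕ} (hN : adim X = N) :
    ∃ l : Fin N → ((δ → ℂ) →ₗ[ℂ] ℂ), ∀ F : MvPolynomial (Fin N) ℂ,
      (∀ x ∈ X, MvPolynomial.eval (fun k => l k x) F = 0) → F = 0 := by
  have : Nonempty X := hX.1.to_subtype
  have := (resRing_isDom hX.irr).isDomain
  let j : resRing X →ₐ[ℂ] FractionRing (resRing X) := Algebra.ofId _ _ |>.restrictScalars ℂ
  have hj : Function.Injective j := IsFractionRing.injective _ _
  have h := adim_zcl_range (resRing X) j hj (fun x : X => (x : δ → ℂ)) (linear_mem_resRing X)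
  rw [Subtype.range_coe, zcl_eq_self hX.2.1, hN] at h
  obtain ⟨l, hl⟩ := exists_algebraicIndependent_of_trd _ h.symm
  refine ⟨l, fun F hF => ?_⟩
  exact (algebraicIndependent_iff_functions j hj
    (fun k => (⟨_, linear_mem_resRing X (l k)⟩ : resRing X))).1 hl F fun x => hF x x.2

theorem polyFun_slice_fst {V W : Type*} [AddCommGroup V] [Module ℂ V] [AddCommGroup W] [Module ℂ W]
    {g : V × W → ℂ} (hg : g ∈ PolyFun (V × W)) (w : W) : (fun v => g (v, w)) ∈ PolyFun V := by
  refine polyFun_comp_mem (PolyFun V) (fun v => (v, w)) (fun l => ?_) hg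
  have : (fun v => l (v, w)) = (fun v => (l ∘ₗ LinearMap.inl ℂ V W) v) +
      algebraMap ℂ (V → ℂ) (l (0, w)) := by
    ext v
    have h : ((v, w) : V × W) = (v, 0) + (0, w) := by simp
    rw [h, map_add]
    simp
  rw [this]
  exact add_mem (linear_mem_polyFun _) (Subalgebra.algebraMap_mem _ _)

theorem vanish_of_dense [Finite I] {N : ℕ} {l : Fin N → ((δ → ℂ) →ₗ[ℂ] ℂ)}
    (hl : ∀ F : MvPolynomial (Fin N) ℂ,
      (∀ x ∈ X, MvPolynomial.eval (fun k => l k x) F = 0) → F = 0)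
    {f : (I → (Fin N → ℂ) × ℂ) → ℂ} (hf : f ∈ piRing (PolyFun ((Fin N → ℂ) × ℂ)) I)
    (h0 : ∀ e : I → X × ℂ, f (fun i => (fun k => l k (e i).1, (e i).2)) = 0) (v) : f v = 0 := by
  refine piRing_eq_zero (Z := Set.range fun z : X × ℂ => ((fun k => l k z.1, z.2) :
    (Fin N → ℂ) × ℂ)) ?_ hf ?_ v
  · rintro g hg hZ ⟨u, t⟩
    obtain ⟨F, hF⟩ := polyOfBasis_surjective (Pi.basisFun ℂ (Fin N))
      ⟨_, polyFun_slice_fst hg t⟩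
    have hF' : ∀ u, MvPolynomial.eval u F = g (u, t) := by
      intro u
      have h1 := congrFun (congrArg Subtype.val hF) u
      rw [polyOfBasis_apply] at h1
      simpa using h1
    have : F = 0 := hl F fun x hx => by
      rw [hF']
      exact hZ _ ⟨(⟨x, hx⟩, t), rfl⟩
    rw [← hF', this, map_zero]
  · intro v hv
    choose e he using hv
    rw [← h0 e]
    congr 1
    ext1 i
    exact (he i).symm

variable {K : Type*} [Field K] [Algebra ℂ K]

theorem algebraicIndependent_points {S B : Type*} [DecidableEq S] [DecidableEq B] [Finite S]
    [Finite B] (j : parRing X (S ⊕ B) →ₐ[ℂ] K) (hj : Function.Injective j)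
    {N : ℕ} {l : Fin N → ((δ → ℂ) →ₗ[ℂ] ℂ)} (hl : ∀ F : MvPolynomial (Fin N) ℂ,
      (∀ x ∈ X, MvPolynomial.eval (fun k => l k x) F = 0) → F = 0) :
    AlgebraicIndependent ℂ (Sum.elim
      (fun sk : S × Fin N => j (sc X (Sum.inl sk.1) * pt X (Sum.inl sk.1) (l sk.2)))
      (fun b : B => j (sc X (Sum.inr b)))) := by
  let g : (S × Fin N) ⊕ B → parRing X (S ⊕ B) := Sum.elim
    (fun sk : S × Fin N => sc X (Sum.inl sk.1) * pt X (Sum.inl sk.1) (l sk.2))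
      (fun b : B => sc X (Sum.inr b))
  have hg : (Sum.elim
      (fun sk : S × Fin N => j (sc X (Sum.inl sk.1) * pt X (Sum.inl sk.1) (l sk.2)))
      (fun b : B => j (sc X (Sum.inr b)))) = fun i => j (g i) := by
    ext (i | i) <;> rfl
  rw [hg, algebraicIndependent_iff_functions j hj]
  intro F hF
  let R' := piRing (PolyFun ((Fin N → ℂ) × ℂ)) (S ⊕ B)
  let p' : S ⊕ B → Fin N → R' := fun i k =>
    ⟨_, comp_apply_mem_piRing (linear_mem_polyFun (LinearMap.proj k ∘ₗ LinearMap.fst ℂ _ _)) i⟩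
  let t' : S ⊕ B → R' := fun i => ⟨_, comp_apply_mem_piRing (linear_mem_polyFun
    (LinearMap.snd ℂ (Fin N → ℂ) ℂ)) i⟩
  let g' : (S × Fin N) ⊕ B → R' := Sum.elim
    (fun sk : S × Fin N => t' (Sum.inl sk.1) * p' (Sum.inl sk.1) sk.2) (fun b : B => t' (Sum.inr b))
  have h0 := vanish_of_dense (I := S ⊕ B) hl (MvPolynomial.aeval g' F).2 (fun e => by
    rw [aeval_apply_eq_eval]
    refine Eq.trans (congrArg (fun z => MvPolynomial.eval z F) (funext ?_)) (hF e)
    rintro (i | i) <;> rfl)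
  refine MvPolynomial.funext fun z => ?_
  have h1 := h0 (Sum.elim (fun s => (fun k => z (Sum.inl (s, k)), 1)) (fun b => (0, z (Sum.inr b))))
  rw [aeval_apply_eq_eval] at h1
  rw [map_zero, ← h1]
  congr 2
  ext (i | i) <;> simp [g', p', t']

theorem algebraicIndependent_point [Finite I] (j : parRing X I →ₐ[ℂ] K)
    (hj : Function.Injective j)
    {N : ℕ} {l : Fin N → ((δ → ℂ) →ₗ[ℂ] ℂ)} (hl : ∀ F : MvPolynomial (Fin N) ℂ,
      (∀ x ∈ X, MvPolynomial.eval (fun k => l k x) F = 0) → F = 0) (s : I) :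
    AlgebraicIndependent ℂ (fun o : Option (Fin N) =>
      j (o.elim (sc X s) (fun k => pt X s (l k)))) := by
  rw [algebraicIndependent_iff_functions j hj]
  intro F hF
  let R' := piRing (PolyFun ((Fin N → ℂ) × ℂ)) I
  let p' : Fin N → R' := fun k =>
    ⟨_, comp_apply_mem_piRing (linear_mem_polyFun (LinearMap.proj k ∘ₗ LinearMap.fst ℂ _ _)) s⟩
  let t' : R' := ⟨_, comp_apply_mem_piRing (linear_mem_polyFun
    (LinearMap.snd ℂ (Fin N → ℂ) ℂ)) s⟩
  let g' : Option (Fin N) → R' := fun o => o.elim t' p'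
  have h0 := vanish_of_dense (I := I) hl (MvPolynomial.aeval g' F).2 (fun e => by
    rw [aeval_apply_eq_eval]
    refine Eq.trans (congrArg (fun z => MvPolynomial.eval z F) (funext ?_)) (hF e)
    rintro (_ | i) <;> rfl)
  refine MvPolynomial.funext fun z => ?_
  have h1 := h0 (fun _ => (fun k => z (some k), z none))
  rw [aeval_apply_eq_eval] at h1
  rw [map_zero, ← h1]
  congr 2
  ext (_ | i) <;> simp [g', p', t']

end parameters

section derivations
variable {K : Type*} [Field K] [Algebra ℂ K] {σ δ : Type*}

/-- The extension of a derivation of the coefficients to polynomials. -/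
def coeffDerivation (σ : Type*) (D : Derivation ℂ K K) :
    Derivation ℂ (MvPolynomial σ K) (MvPolynomial σ K) :=
  Derivation.mk'
    { toFun := fun p => AddMonoidAlgebra.map (D : K →+ K) p
      map_add' := fun p q => by
        ext m
        change D (p.coeff m + q.coeff m) = D (p.coeff m) + D (q.coeff m)
        exact map_add _ _ _
      map_smul' := fun c p => by
        ext m
        change D (c • p.coeff m) = c • D (p.coeff m)
        exact D.map_smul _ _ } fun p q => by
    classical
    ext m
    change D (MvPolynomial.coeff m (p * q)) = MvPolynomial.coeff m (p * _ + q * _)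
    rw [MvPolynomial.coeff_add, mul_comm q, MvPolynomial.coeff_mul, MvPolynomial.coeff_mul,
      MvPolynomial.coeff_mul, map_sum, ← Finset.sum_add_distrib]
    refine Finset.sum_congr rfl fun z _ => ?_
    rw [D.leibniz, smul_eq_mul, smul_eq_mul, mul_comm (MvPolynomial.coeff z.2 q)]
    rfl

theorem coeffDerivation_coeff (D : Derivation ℂ K K) (p : MvPolynomial σ K) (m : σ →₀ ℕ) :
    MvPolynomial.coeff m (coeffDerivation σ D p) = D (MvPolynomial.coeff m p) := rfl

theorem coeffDerivation_C (D : Derivation ℂ K K) (a : K) :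
    coeffDerivation σ D (MvPolynomial.C a) = MvPolynomial.C (D a) := by
  classical
  ext m
  rw [coeffDerivation_coeff, MvPolynomial.coeff_C, MvPolynomial.coeff_C]
  split_ifs <;> simp

theorem coeffDerivation_X (D : Derivation ℂ K K) (i : σ) :
    coeffDerivation σ D (MvPolynomial.X i) = 0 := by
  classical
  ext m
  rw [coeffDerivation_coeff, MvPolynomial.coeff_X]
  split_ifs <;> simp

theorem X_dvd_of_eval_eq_zero (i : σ) [DecidableEq σ] {p : MvPolynomial σ K}
    (hp : ∀ u : σ → ℂ, u i = 0 → MvPolynomial.eval (fun k => algebraMap ℂ K (u k)) p = 0) :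
    MvPolynomial.X i ∣ p := by
  let ψ : MvPolynomial σ K →ₐ[K] MvPolynomial σ K :=
    MvPolynomial.aeval (Function.update MvPolynomial.X i 0)
  have h1 : (Ideal.Quotient.mkₐ K (Ideal.span {(MvPolynomial.X i : MvPolynomial σ K)})).comp ψ =
      Ideal.Quotient.mkₐ K _ := by
    refine MvPolynomial.algHom_ext fun k => ?_
    rcases eq_or_ne k i with rfl | hk
    · simp [ψ]
    · simp [ψ, hk]
  have h2 : ψ p = 0 := by
    refine MvPolynomial.funext_set (fun _ => Set.range (algebraMap ℂ K))
      (fun _ => Set.infinite_range_of_injective (algebraMap ℂ K).injective) fun x hx => ?_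
    choose u hu using fun k => hx k (Set.mem_univ k)
    have h3 := hp (Function.update u i 0) (by simp)
    rw [map_zero, ← h3]
    have h4 : (MvPolynomial.aeval x).comp ψ =
        MvPolynomial.aeval (fun k => algebraMap ℂ K (Function.update u i 0 k)) := by
      refine MvPolynomial.algHom_ext fun k => ?_
      rcases eq_or_ne k i with rfl | hk
      · simp [ψ]
      · simp [ψ, hk, hu]
    exact DFunLike.congr_fun h4 p
  have h5 := DFunLike.congr_fun h1 p
  simp only [AlgHom.comp_apply, h2, map_zero, Ideal.Quotient.mkₐ_eq_mk] at h5
  exact Ideal.mem_span_singleton.1 (Ideal.Quotient.eq_zero_iff_mem.1 h5.symm)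

/-- A derivation that preserves the span of a family of vectors preserves each line spanned by
a vector of the family, if some polynomial with constant coefficients vanishes on the spans of
the proper subfamilies only. -/
theorem derivation_offdiag_eq_zero {J : Type*} [Fintype J] [DecidableEq J] (D : Derivation ℂ K K)
    (q : J → δ → K) (c : J → J → K) (hc : ∀ i d, D (q i d) = ∑ l, c i l * q l d)
    (F : MvPolynomial δ ℂ)
    (hF0 : ∀ i, ∀ u : J → ℂ, u i = 0 →
      MvPolynomial.aeval (fun d => ∑ k, algebraMap ℂ K (u k) * q k d) F = 0)
    (hF1 : MvPolynomial.aeval (fun d => ∑ k, q k d) F ≠ 0) (i k : J) (hik : k ≠ i) :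
    c k i = 0 := by
  let y : δ → MvPolynomial J K := fun d => ∑ k, MvPolynomial.X k * MvPolynomial.C (q k d)
  let Φ : MvPolynomial J K := MvPolynomial.aeval y F
  have hev : ∀ v : J → K, MvPolynomial.eval v Φ =
      MvPolynomial.aeval (fun d => ∑ k, v k * q k d) F := by
    intro v
    have : ((MvPolynomial.aeval v : MvPolynomial J K →ₐ[K] K).restrictScalars ℂ).comp
        (MvPolynomial.aeval y) = MvPolynomial.aeval (fun d => ∑ k, v k * q k d) := by
      refine MvPolynomial.algHom_ext fun d => ?_
      simp [y]
    exact DFunLike.congr_fun this F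
  let E : Derivation ℂ (MvPolynomial J K) (MvPolynomial J K) :=
    coeffDerivation J D - (MvPolynomial.mkDerivation K
      (fun l => ∑ k, MvPolynomial.X k * MvPolynomial.C (c k l))).restrictScalars ℂ
  have hEX : ∀ l, E (MvPolynomial.X l) = -∑ k, MvPolynomial.X k * MvPolynomial.C (c k l) := by
    intro l
    simp [E, coeffDerivation_X, MvPolynomial.mkDerivation_X]
  have hEC : ∀ a, E (MvPolynomial.C a) = MvPolynomial.C (D a) := by
    intro a
    simp [E, coeffDerivation_C]
  have hEy : ∀ d, E (y d) = 0 := by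
    intro d
    simp only [y, map_sum, Derivation.leibniz, hEX, hEC, hc, smul_eq_mul, map_mul,
      Finset.sum_add_distrib, mul_neg, Finset.sum_neg_distrib, Finset.mul_sum]
    rw [Finset.sum_comm, add_neg_eq_zero]
    refine Finset.sum_congr rfl fun a _ => Finset.sum_congr rfl fun b _ => by ring
  have hEΦ : E Φ = 0 := by
    have : ∀ F : MvPolynomial δ ℂ, E (MvPolynomial.aeval y F) = 0 := by
      intro F
      induction F using MvPolynomial.induction_on with
      | C a => rw [MvPolynomial.aeval_C]; exact E.map_algebraMap a
      | add p q hp hq => simp [hp, hq]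
      | mul_X p d hp => simp [hp, hEy]
    exact this F
  have hΦ : Φ ≠ 0 := by
    intro h
    have h1 := hev 1
    simp only [h, map_zero, Pi.one_apply, one_mul] at h1
    exact hF1 h1.symm
  have hdvd : MvPolynomial.X i ∣ Φ :=
    X_dvd_of_eval_eq_zero i fun u hu => by rw [hev]; exact hF0 i u hu
  have hprime : Prime (MvPolynomial.X i : MvPolynomial J K) := MvPolynomial.X_prime
  have hfin := FiniteMultiplicity.of_prime_left hprime hΦ
  obtain ⟨G, hG, hGi⟩ := hfin.exists_eq_pow_mul_and_not_dvd
  have hM : multiplicity (MvPolynomial.X i) Φ ≠ 0 := by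
    intro h
    rw [h, pow_zero, one_mul] at hG
    exact hGi (hG ▸ hdvd)
  obtain ⟨M, hM⟩ := Nat.exists_eq_succ_of_ne_zero hM
  rw [hM] at hG
  have hdvd2 : (MvPolynomial.X i : MvPolynomial J K) ∣ E (MvPolynomial.X i) := by
    rw [hG, Derivation.leibniz, Derivation.leibniz_pow] at hEΦ
    simp only [smul_eq_mul, nsmul_eq_mul, Nat.succ_eq_add_one, Nat.add_sub_cancel, pow_succ]
      at hEΦ
    have h1 : (MvPolynomial.X i : MvPolynomial J K) ^ M *
        (MvPolynomial.X i * E G + G * (((M + 1 : ℕ) : MvPolynomial J K) * E (MvPolynomial.X i)))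
          = 0 := by
      rw [← hEΦ]; ring
    have h2 := (mul_eq_zero.1 h1).resolve_left (pow_ne_zero _ hprime.ne_zero)
    have h3 : (MvPolynomial.X i : MvPolynomial J K) ∣
        G * (((M + 1 : ℕ) : MvPolynomial J K) * E (MvPolynomial.X i)) :=
      ⟨-E G, by linear_combination h2⟩
    have h4 := (hprime.dvd_or_dvd h3).resolve_left hGi
    refine (hprime.dvd_or_dvd h4).resolve_left fun h5 => ?_
    obtain ⟨H, hH⟩ := h5
    have h6 := congrArg (MvPolynomial.eval (0 : J → K)) hH
    have : CharZero K := charZero_of_injective_algebraMap (algebraMap ℂ K).injective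
    simp only [map_natCast, map_mul, MvPolynomial.eval_X, Pi.zero_apply, zero_mul] at h6
    exact Nat.cast_ne_zero.2 M.succ_ne_zero h6
  obtain ⟨H, hH⟩ := hdvd2
  rw [hEX] at hH
  have h7 := congrArg (MvPolynomial.eval (Pi.single k 1 : J → K)) hH
  simp [Pi.single_apply, hik.symm] at h7
  exact h7

end derivations

section minors
variable {K : Type*} [Field K] {δ J : Type*} [Fintype J] [DecidableEq J]

/-- The maximal minor of a matrix with given columns. -/
def minor {A : Type*} [CommRing A] (q : J → δ → A) (c : J → δ) : A :=
  (Matrix.of fun i k => q i (c k)).det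

theorem map_minor {A A' F : Type*} [CommRing A] [CommRing A'] [FunLike F A A']
    [RingHomClass F A A'] (f : F) (q : J → δ → A) (c : J → δ) :
    f (minor q c) = minor (fun i d => f (q i d)) c :=
  RingHom.map_det (f : A →+* A') _

theorem linearIndependent_of_minor_ne_zero {q : J → δ → K} {c : J → δ} (h : minor q c ≠ 0) :
    LinearIndependent K q :=
  LinearIndependent.of_comp (LinearMap.funLeft K K c)
    (Matrix.linearIndependent_rows_of_det_ne_zero h)

theorem exists_minor_ne_zero [Finite δ] {q : J → δ → K} (hq : LinearIndependent K q) :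
    ∃ c, minor q c ≠ 0 := by
  have := Fintype.ofFinite δ
  let M : Matrix J δ K := Matrix.of q
  have hr : M.rank = Fintype.card J := LinearIndependent.rank_matrix (M := M) hq
  rw [Matrix.rank_eq_finrank_span_cols] at hr
  obtain ⟨κ, a, ha, hspan, hli⟩ := exists_linearIndependent' K M.col
  have : Finite κ := Finite.of_injective a ha
  have := Fintype.ofFinite κ
  have hcard : Fintype.card κ = Fintype.card J := by
    rw [← hr, ← hspan, finrank_span_eq_card hli]
  let e : J ≃ κ := Fintype.equivOfCardEq hcard.symm
  refine ⟨fun k => a (e k), ?_⟩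
  have h2 : LinearIndependent K (Matrix.of fun i k => q i (a (e k))).col :=
    hli.comp e e.injective
  rw [Matrix.linearIndependent_cols_iff_isUnit, Matrix.isUnit_iff_isUnit_det] at h2
  exact h2.ne_zero

theorem minor_smul (t : J → K) (q : J → δ → K) (c : J → δ) :
    minor (fun i d => t i * q i d) c = (∏ i, t i) * minor q c := by
  simp only [minor]
  rw [← Matrix.det_mul_column]
  rfl

variable [Algebra ℂ K]

theorem derivation_prod {ι : Type*} (s : Finset ι) (D : Derivation ℂ K K) (f c : ι → K)
    (h : ∀ i, D (f i) = c i * f i) : D (∏ i ∈ s, f i) = (∑ i ∈ s, c i) * ∏ i ∈ s, f i := by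
  classical
  induction s using Finset.induction_on with
  | empty => simp
  | insert i s hi ih =>
    rw [Finset.prod_insert hi, Finset.sum_insert hi, D.leibniz, ih, h, smul_eq_mul, smul_eq_mul]
    ring

theorem derivation_minor (D : Derivation ℂ K K) {q : J → δ → K} {c : J → K}
    (h : ∀ i d, D (q i d) = c i * q i d) (b : J → δ) :
    D (minor q b) = (∑ i, c i) * minor q b := by
  simp only [minor, Matrix.det_apply, map_sum, Finset.mul_sum]
  refine Finset.sum_congr rfl fun σ _ => ?_
  have h1 := derivation_prod Finset.univ D (fun i => q (σ i) (b i)) (fun i => c (σ i))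
    fun i => h _ _
  rw [Equiv.sum_comp σ c] at h1
  simp only [Matrix.of_apply, Units.smul_def, zsmul_eq_mul, D.leibniz, D.map_intCast,
    smul_eq_mul, mul_zero, add_zero, h1]
  ring

/-- A derivation killing the maximal minors acts on the rows by a matrix. -/
theorem exists_derivation_rows {D : Derivation ℂ K K} {q : J → δ → K} {b : J → δ}
    (hb : minor q b ≠ 0) (hD : ∀ c, D (minor q c) = 0) :
    ∃ c : J → J → K, ∀ i d, D (q i d) = ∑ l, c i l * q l d := by
  let Q : Matrix J J K := Matrix.of fun i k => q i (b k)
  let w : δ → J → K := fun d k => minor q (Function.update b k d) / minor q b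
  have hw : ∀ d i, q i d = ∑ k, q i (b k) * w d k := by
    intro d i
    have h1 := congrFun (Matrix.mulVec_cramer Q (fun i => q i d)) i
    simp only [Matrix.mulVec, dotProduct, Matrix.cramer_apply, Pi.smul_apply, smul_eq_mul] at h1
    have h2 : ∀ k, (Q.updateCol k fun i => q i d).det = minor q (Function.update b k d) := by
      intro k
      simp only [minor]
      congr 1
      ext i l
      rcases eq_or_ne l k with rfl | hlk
      · simp
      · simp [hlk, Q]
    simp only [h2] at h1
    have h3 : Q.det = minor q b := rfl
    simp only [w, ← mul_div_assoc, ← Finset.sum_div]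
    rw [eq_div_iff hb, ← h3, mul_comm, ← h1]
    rfl
  have hDw : ∀ d k, D (w d k) = 0 := by
    intro d k
    simp [w, Derivation.leibniz_div, hD]
  have hQ : IsUnit Q.det := (show Q.det ≠ 0 from hb).isUnit
  let DQ : Matrix J J K := Matrix.of fun i k => D (q i (b k))
  refine ⟨DQ * Q⁻¹, fun i d => ?_⟩
  have h5 : (fun l => q l d) = Q.mulVec (w d) := by
    ext l
    exact hw d l
  have h6 : (fun i => D (q i d)) = DQ.mulVec (w d) := by
    ext l
    rw [hw d l]
    simp only [map_sum, D.leibniz, hDw, smul_eq_mul, DQ, Matrix.of_apply, Matrix.mulVec, dotProduct]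
    exact Finset.sum_congr rfl fun k _ => by ring
  have h7 : (DQ * Q⁻¹).mulVec (fun l => q l d) = fun i => D (q i d) := by
    rw [h5, h6, Matrix.mulVec_mulVec, Matrix.mul_assoc, Matrix.nonsing_inv_mul _ hQ,
      Matrix.mul_one]
  exact (congrFun h7 i).symm

end minors

section rows
variable {K : Type*} [Field K] {δ J L : Type*} [Fintype L]

/-- The vectors `x_i + ∑ l, B_il x_l`. -/
def rows {A : Type*} [CommRing A] (x : J ⊕ L → δ → A) (B : J → L → A) (i : J) (d : δ) : A :=
  x (Sum.inl i) d + ∑ l, B i l * x (Sum.inr l) d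

theorem map_rows {A A' F : Type*} [CommRing A] [CommRing A'] [FunLike F A A']
    [RingHomClass F A A'] (f : F) (x : J ⊕ L → δ → A) (B : J → L → A) (i : J) (d : δ) :
    f (rows x B i d) = rows (fun s d => f (x s d)) (fun i l => f (B i l)) i d := by
  simp [rows]

theorem rows_linearIndependent [Fintype J] [DecidableEq J] {x : J ⊕ L → δ → K}
    (hx : LinearIndependent K x) (B : J → L → K) : LinearIndependent K (rows x B) := by
  rw [Fintype.linearIndependent_iff] at hx ⊢
  intro g hg i
  have h := hx (Sum.elim g fun l => ∑ k, g k * B k l) (by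
    rw [← hg]
    ext d
    simp only [Fintype.sum_sum_type, Sum.elim_inl, Sum.elim_inr, Finset.sum_apply,
      Pi.smul_apply, smul_eq_mul, rows, mul_add, Finset.mul_sum, Finset.sum_add_distrib,
      Finset.sum_mul, mul_assoc]
    rw [Finset.sum_comm]) (Sum.inl i)
  simpa using h

variable [Algebra ℂ K]

theorem mem_aclField {S : Set K} {y : K} : y ∈ aclField S ↔ y ∈ acl S := by
  rw [← coe_aclField]; rfl

theorem trd_iUnion_le {ι : Type*} [Fintype ι] (f : ι → Set K) :
    trd (⋃ i, f i) ≤ ∑ i, trd (f i) := by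
  classical
  have h : ∀ s : Finset ι, trd (⋃ i ∈ s, f i) ≤ ∑ i ∈ s, trd (f i) := by
    intro s
    induction s using Finset.induction_on with
    | empty => simpa using trd_le_encard (∅ : Set K)
    | insert i s hi ih =>
      rw [Finset.set_biUnion_insert, Finset.sum_insert hi]
      exact (trd_union_le _ _).trans (by gcongr)
  simpa using h Finset.univ

theorem trd_range_le {ι : Type*} [Fintype ι] (f : ι → K) :
    trd (Set.range f) ≤ Fintype.card ι := by
  refine (trd_le_encard _).trans ?_
  rw [← Set.image_univ]
  refine (Set.encard_image_le f _).trans ?_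
  simp

variable [Fintype J] [DecidableEq J]

/-- If the minors of the rows have the maximal possible transcendence degree, then the affine
coordinates of the points are algebraic over the ratios of the minors. -/
theorem coord_mem_acl_ratios {x : J ⊕ L → δ → K} {B : J → L → K} {b : δ}
    (hb : ∀ s, x s b ≠ 0) {n : ℕ}
    (hx : ∀ s, trd (Set.range fun d => x s d / x s b) ≤ n)
    (hm : ((n * (Fintype.card J + Fintype.card L) + Fintype.card J * Fintype.card L + 1 : ℕ) : ℕ∞)
      ≤ trd (Set.range (minor (rows x B))))
    {c₀ : J → δ} (hc₀ : minor (rows x B) c₀ ≠ 0) (s : J ⊕ L) (d : δ) :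
    x s d / x s b ∈ acl (Set.range fun c => minor (rows x B) c / minor (rows x B) c₀) := by
  set ρ := Set.range fun c => minor (rows x B) c / minor (rows x B) c₀ with hρ
  let y : J ⊕ L → δ → K := fun s d => x s d / x s b
  let C : J → L → K := fun i l => B i l * x (Sum.inr l) b / x (Sum.inl i) b
  let P : Set K := (⋃ s, Set.range (y s)) ∪ Set.range fun z : J × L => C z.1 z.2
  set N := n * (Fintype.card J + Fintype.card L) + Fintype.card J * Fintype.card L with hN
  have hP : trd P ≤ (N : ℕ) := by
    refine (trd_union_le _ _).trans ?_
    have h1 := (trd_iUnion_le fun s => Set.range (y s)).trans (Finset.sum_le_sum fun s _ => hx s)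
    refine (add_le_add h1 (trd_range_le _)).trans (le_of_eq ?_)
    simp only [Finset.sum_const, Finset.card_univ, Fintype.card_sum, Fintype.card_prod, hN]
    push_cast
    simp [mul_comm]
  have hy : ∀ s d, y s d ∈ aclField P := fun s d =>
    mem_aclField.2 (subset_acl _ (Or.inl (Set.mem_iUnion.2 ⟨s, d, rfl⟩)))
  have hC : ∀ i l, C i l ∈ aclField P := fun i l =>
    mem_aclField.2 (subset_acl _ (Or.inr ⟨(i, l), rfl⟩))
  have hrow : rows x B = fun i d => x (Sum.inl i) b * rows y C i d := by
    ext i d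
    have h1 := hb (Sum.inl i)
    simp only [rows, y, C, mul_add, Finset.mul_sum]
    congr 1
    · field_simp
    · refine Finset.sum_congr rfl fun l _ => ?_
      have h2 := hb (Sum.inr l)
      field_simp
  have hprod : (∏ i : J, x (Sum.inl i) b) ≠ 0 := Finset.prod_ne_zero_iff.2 fun i _ => hb _
  have hmin : ∀ c, minor (rows y C) c ∈ aclField P := by
    intro c
    simp only [minor, Matrix.det_apply, Units.smul_def, zsmul_eq_mul, Matrix.of_apply, rows]
    exact sum_mem fun σ _ => mul_mem (intCast_mem _ _) (prod_mem fun i _ =>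
      add_mem (hy _ _) (sum_mem fun l _ => mul_mem (hC _ _) (hy _ _)))
  have hρP : ρ ⊆ acl P := by
    rintro _ ⟨c, rfl⟩
    simp only [hrow, minor_smul, mul_div_mul_left _ _ hprod]
    exact mem_aclField.1 (div_mem (hmin _) (hmin _))
  have hle : (N : ℕ∞) ≤ trd ρ := by
    have h1 : trd (Set.range (minor (rows x B))) ≤ trd (ρ ∪ {minor (rows x B) c₀}) := by
      refine trd_le_of_subset_acl ?_
      rintro _ ⟨c, rfl⟩
      rw [← div_mul_cancel₀ (minor (rows x B) c) hc₀]
      exact mem_aclField.1 (mul_mem (mem_aclField.2 (subset_acl _ (Or.inl ⟨c, rfl⟩)))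
        (mem_aclField.2 (subset_acl _ (Or.inr rfl))))
    have h2 := (hm.trans h1).trans (trd_union_le _ _)
    have h3 : trd {minor (rows x B) c₀} ≤ 1 := (trd_le_encard _).trans (by simp)
    have h4 := h2.trans (add_le_add le_rfl h3)
    rw [Nat.cast_add, Nat.cast_one] at h4
    exact (ENat.add_le_add_iff_right (by simp)).1 h4
  have hfin : trd ρ ≠ ⊤ := ne_top_of_le_ne_top (ENat.natCast_ne_top N)
    ((trd_le_of_subset_acl hρP).trans hP)
  have hacl : acl ρ = acl (ρ ∪ P) := by
    refine acl_eq_of_trd_le hfin Set.subset_union_left ?_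
    exact ((trd_le_of_subset_acl (Set.union_subset hρP (subset_acl _))).trans hP).trans hle
  rw [hacl]
  exact subset_acl _ (Or.inr (Or.inl (Set.mem_iUnion.2 ⟨s, d, rfl⟩)))

end rows

section core
variable {K : Type*} [Field K] {δ : Type*}

theorem rows_map {J J' L : Type*} [Fintype L] (x : J ⊕ L → δ → K) (B : J → L → K) (ρ : J' → J) :
    rows (fun s => x (Sum.map ρ id s)) (fun i => B (ρ i)) = fun i => rows x B (ρ i) := rfl

variable [Algebra ℂ K] [Finite δ]

/-- If the Plücker coordinates of all the spaces spanned by all but one of the rows have the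
maximal possible transcendence degree, then so do the Plücker coordinates of the space spanned
by all the rows. -/
theorem le_trd_minors {a m n : ℕ} {x : Fin (a + 2) ⊕ Fin m → δ → K} {B : Fin (a + 2) → Fin m → K}
    {b : δ} (hb : ∀ s, x s b ≠ 0) (hx : LinearIndependent K x)
    (hn : ∀ s, trd (Set.range fun d => x s d / x s b) ≤ n)
    (hparam : (((n + 1) * (a + 2 + m) + (a + 2) * m : ℕ) : ℕ∞) ≤
      trd ((Set.range fun z : (Fin (a + 2) ⊕ Fin m) × δ => x z.1 z.2) ∪
        Set.range fun z : Fin (a + 2) × Fin m => B z.1 z.2))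
    (F : MvPolynomial δ ℂ)
    (hF0 : ∀ i, ∀ u : Fin (a + 2) → ℂ, u i = 0 →
      MvPolynomial.aeval (fun d => ∑ k, algebraMap ℂ K (u k) * rows x B k d) F = 0)
    (hF1 : MvPolynomial.aeval (fun d => ∑ k, rows x B k d) F ≠ 0)
    (hm : ∀ i : Fin (a + 2), ((n * (a + 1 + m) + (a + 1) * m + 1 : ℕ) : ℕ∞) ≤
      trd (Set.range (minor fun k => rows x B (i.succAbove k)))) :
    ((n * (a + 2 + m) + (a + 2) * m + 1 : ℕ) : ℕ∞) ≤ trd (Set.range (minor (rows x B))) := by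
  have hq := rows_linearIndependent hx B
  obtain ⟨c₀, hc₀⟩ := exists_minor_ne_zero hq
  have hq' : ∀ i : Fin (a + 2), ∃ c, minor (fun k => rows x B (i.succAbove k)) c ≠ 0 := fun i =>
    exists_minor_ne_zero (hq.comp _ Fin.succAbove_right_injective)
  choose c' hc' using hq'
  let T : Set K := Set.range fun s : {s : Fin (a + 2) ⊕ Fin m // s ≠ Sum.inl 0} => x s b
  have key : ∀ D : Derivation ℂ K K, (∀ t ∈ Set.range (minor (rows x B)) ∪ T, D t = 0) →
      (∀ s d, D (x s d) = 0) ∧ ∀ i l, D (B i l) = 0 := by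
    intro D hD
    have hDm : ∀ c, D (minor (rows x B) c) = 0 := fun c => hD _ (Or.inl ⟨c, rfl⟩)
    have hDT : ∀ s, s ≠ Sum.inl 0 → D (x s b) = 0 := fun s hs => hD _ (Or.inr ⟨⟨s, hs⟩, rfl⟩)
    obtain ⟨c, hc⟩ := exists_derivation_rows hc₀ hDm
    have hoff := derivation_offdiag_eq_zero D (rows x B) c hc F hF0 hF1
    have hdiag : ∀ i d, D (rows x B i d) = c i i * rows x B i d := by
      intro i d
      rw [hc, Finset.sum_eq_single i]
      · intro k _ hk
        rw [hoff k i hk.symm, zero_mul]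
      · simp
    have htr : ∑ i, c i i = 0 := by
      have h1 := derivation_minor D hdiag c₀
      rw [hDm] at h1
      exact (mul_eq_zero.1 h1.symm).resolve_right hc₀
    have haff : ∀ i : Fin (a + 2), ∀ s, s ≠ Sum.inl i → ∀ d, D (x s d / x s b) = 0 := by
      intro i s hs d
      have hs' : ∃ s', Sum.map i.succAbove id s' = s := by
        rcases s with k | l
        · obtain ⟨k', hk'⟩ := Fin.exists_succAbove_eq (x := k) (y := i) (by rintro rfl; exact hs rfl)
          exact ⟨Sum.inl k', by simp [hk']⟩
        · exact ⟨Sum.inr l, rfl⟩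
      obtain ⟨s', rfl⟩ := hs'
      have h1 := coord_mem_acl_ratios (x := fun s => x (Sum.map i.succAbove id s))
        (B := fun k => B (i.succAbove k)) (b := b) (fun s => hb _) (n := n) (fun s => hn _)
        (by rw [rows_map]; simpa using hm i) (c₀ := c' i) (by rw [rows_map]; exact hc' i) s' d
      refine derivation_eq_zero_of_mem_acl h1 D ?_
      rintro _ ⟨e, rfl⟩
      have h2 := derivation_minor D (q := fun k => rows x B (i.succAbove k))
        (c := fun k => c (i.succAbove k) (i.succAbove k)) (fun _ _ => hdiag _ _)
      simp only [rows_map, Derivation.leibniz_div, h2, smul_eq_mul]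
      ring
    have haff' : ∀ s d, D (x s d / x s b) = 0 := by
      intro s d
      by_cases hs : s = Sum.inl 0
      · exact haff 1 s (by rw [hs]; simp) d
      · exact haff 0 s hs d
    have hDx : ∀ s d, D (x s d) = x s d / x s b * D (x s b) := by
      intro s d
      conv_lhs => rw [← div_mul_cancel₀ (x s d) (hb s)]
      rw [D.leibniz, haff', smul_zero, add_zero, smul_eq_mul]
    have hDx' : ∀ s, s ≠ Sum.inl 0 → ∀ d, D (x s d) = 0 := fun s hs d => by
      rw [hDx, hDT s hs, mul_zero]
    have hrel : ∀ i d, D (x (Sum.inl i) b) / x (Sum.inl i) b * x (Sum.inl i) d +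
        ∑ l, D (B i l) * x (Sum.inr l) d =
        c i i * x (Sum.inl i) d + ∑ l, c i i * B i l * x (Sum.inr l) d := by
      intro i d
      have h1 : D (rows x B i d) = D (x (Sum.inl i) d) + ∑ l, D (B i l) * x (Sum.inr l) d := by
        simp only [rows, map_add, map_sum, D.leibniz, hDx' (Sum.inr _) (by simp), smul_eq_mul,
          mul_zero, zero_add, mul_comm]
      rw [hdiag, hDx] at h1
      simp only [rows, mul_add, Finset.mul_sum, ← mul_assoc] at h1
      rw [h1, div_mul_eq_mul_div, div_mul_eq_mul_div, mul_comm (x (Sum.inl i) d)]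
    have hli : ∀ i, D (x (Sum.inl i) b) / x (Sum.inl i) b = c i i ∧
        ∀ l, D (B i l) = c i i * B i l := by
      intro i
      have h1 := Fintype.linearIndependent_iff.1 hx
        (Sum.elim (Pi.single i (D (x (Sum.inl i) b) / x (Sum.inl i) b - c i i))
          fun l => D (B i l) - c i i * B i l) (by
          ext d
          have h2 := hrel i d
          simp only [Fintype.sum_sum_type, Sum.elim_inl, Sum.elim_inr, Finset.sum_apply,
            Pi.smul_apply, smul_eq_mul, Pi.zero_apply, sub_mul,
            Finset.sum_sub_distrib]
          rw [Finset.sum_eq_single i (fun k _ hk => by simp [hk]) (by simp), Pi.single_eq_same]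
          linear_combination h2)
      refine ⟨?_, fun l => ?_⟩
      · have := h1 (Sum.inl i)
        simpa [sub_eq_zero] using this
      · have := h1 (Sum.inr l)
        simpa [sub_eq_zero] using this
    have hc1 : ∀ i, i ≠ 0 → c i i = 0 := by
      intro i hi
      rw [← (hli i).1, hDT _ (by simpa using hi), zero_div]
    have hc : ∀ i, c i i = 0 := by
      intro i
      by_cases hi : i = 0
      · rw [Finset.sum_eq_single 0 (fun k _ hk => hc1 k hk) (by simp)] at htr
        rw [hi, htr]
      · exact hc1 i hi
    refine ⟨fun s d => ?_, fun i l => by rw [(hli i).2, hc, zero_mul]⟩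
    by_cases hs : s = Sum.inl 0
    · have h1 := (hli 0).1
      rw [hc, div_eq_zero_iff, or_iff_left (hb _)] at h1
      rw [hDx, hs, h1, mul_zero]
    · exact hDx' s hs d
  have hle := trd_le_of_subset_acl (S := (Set.range fun z : (Fin (a + 2) ⊕ Fin m) × δ => x z.1 z.2) ∪
        Set.range fun z : Fin (a + 2) × Fin m => B z.1 z.2)
        (T := Set.range (minor (rows x B)) ∪ T) (by
    rintro _ (⟨z, rfl⟩ | ⟨z, rfl⟩)
    · exact mem_acl_of_derivation fun D hD => (key D hD).1 _ _
    · exact mem_acl_of_derivation fun D hD => (key D hD).2 _ _)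
  have hT : trd T ≤ ((a + 1 + m : ℕ) : ℕ∞) := by
    refine (trd_range_le _).trans (le_of_eq ?_)
    rw [Fintype.card_subtype_compl]
    simp
  have h1 := (hparam.trans hle).trans ((trd_union_le _ _).trans (add_le_add le_rfl hT))
  rw [show (n + 1) * (a + 2 + m) + (a + 2) * m =
    n * (a + 2 + m) + (a + 2) * m + 1 + (a + 1 + m) by ring, Nat.cast_add _ (a + 1 + m)] at h1
  exact (ENat.add_le_add_iff_right (by simp)).1 h1

end core

section generic
variable {δ I J L : Type*} {X : Set (δ → ℂ)} [DecidableEq I] [DecidableEq J] [DecidableEq L]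

/-- Evaluation of parameter functions. -/
def ev (e : I → X × ℂ) : parRing X I →ₐ[ℂ] ℂ :=
  (Pi.evalAlgHom ℂ (fun _ => ℂ) e).comp (parRing X I).val

@[simp] theorem ev_sc (e : I → X × ℂ) (i : I) : ev e (sc X i) = (e i).2 := rfl

@[simp] theorem ev_pt (e : I → X × ℂ) (i : I) (l : (δ → ℂ) →ₗ[ℂ] ℂ) :
    ev e (pt X i l) = l (e i).1 := rfl

theorem parRing_ext {f g : parRing X I} (h : ∀ e, ev e f = ev e g) : f = g :=
  Subtype.ext (funext h)

/-- The coordinates of the generic points of the cone. -/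
def gpt (X : Set (δ → ℂ)) (J L : Type*) [DecidableEq J] [DecidableEq L] (s : J ⊕ L) (d : δ) :
    parRing X ((J ⊕ L) ⊕ (J × L)) :=
  sc X (Sum.inl s) * pt X (Sum.inl s) (LinearMap.proj d)

/-- The generic coefficients. -/
def gco (X : Set (δ → ℂ)) (J L : Type*) [DecidableEq J] [DecidableEq L] (i : J) (l : L) :
    parRing X ((J ⊕ L) ⊕ (J × L)) :=
  sc X (Sum.inr (i, l))

@[simp] theorem ev_gpt (e : (J ⊕ L) ⊕ (J × L) → X × ℂ) (s : J ⊕ L) (d : δ) :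
    ev e (gpt X J L s d) = (e (Sum.inl s)).2 * (e (Sum.inl s)).1.1 d := rfl

@[simp] theorem ev_gco (e : (J ⊕ L) ⊕ (J × L) → X × ℂ) (i : J) (l : L) :
    ev e (gco X J L i l) = (e (Sum.inr (i, l))).2 := rfl

variable {K : Type*} [Field K] [Algebra ℂ K]

theorem trd_le_adim {T W : Type*} [AddCommGroup W] [Module ℂ W] [FiniteDimensional ℂ W]
    {Y : Set W} (hY : IsAlgSet Y) (R : Subalgebra ℂ (T → ℂ)) (j : R →ₐ[ℂ] K)
    (hj : Function.Injective j) (φ : T → W) (hφ : ∀ l : W →ₗ[ℂ] ℂ, (fun t => l (φ t)) ∈ R)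
    (h : ∀ t, φ t ∈ Y) :
    trd (Set.range fun l : W →ₗ[ℂ] ℂ => j ⟨_, hφ l⟩) ≤ adim Y := by
  rw [← adim_zcl_range R j hj φ hφ]
  exact adim_mono (zcl_minimal hY (Set.range_subset_iff.2 h))

theorem pt_eq_sum [Fintype δ] [DecidableEq δ] (i : I) (l : (δ → ℂ) →ₗ[ℂ] ℂ) :
    pt X i l = ∑ d, l (Pi.single d 1) • pt X i (LinearMap.proj d) := by
  refine parRing_ext fun e => ?_
  simp only [map_sum, map_smul, ev_pt, LinearMap.proj_apply, smul_eq_mul]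
  rw [LinearMap.pi_apply_eq_sum_univ l]
  refine Finset.sum_congr rfl fun d _ => ?_
  rw [smul_eq_mul, mul_comm]
  congr 3
  ext k
  simp [Pi.single_apply, eq_comm]

variable [Finite δ]

theorem trd_pt_le (hX : IsAlgSet X) (j : parRing X I →ₐ[ℂ] K) (hj : Function.Injective j) (i : I) :
    trd (Set.range fun l => j (pt X i l)) ≤ adim X :=
  trd_le_adim hX _ j hj (fun e => ((e i).1 : δ → ℂ)) (fun l => (pt X i l).2) fun e => (e i).1.2

theorem trd_sc_mul_pt_le (hX : IsAlgSet X) (hc : IsCone X) (j : parRing X I →ₐ[ℂ] K)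
    (hj : Function.Injective j) (i : I) :
    trd (Set.range fun l => j (sc X i * pt X i l)) ≤ adim X := by
  have h : ∀ l : (δ → ℂ) →ₗ[ℂ] ℂ, (fun e : I → X × ℂ => l ((e i).2 • ((e i).1 : δ → ℂ))) =
      (sc X i * pt X i l : parRing X I).1 := by
    intro l
    ext e
    simp
  have h2 := trd_le_adim hX _ j hj (fun e => (e i).2 • ((e i).1 : δ → ℂ))
    (fun l => h l ▸ (sc X i * pt X i l).2) fun e => hc.2 _ _ (e i).1.2
  convert h2 using 5 with l
  exact Subtype.ext (h l).symm

/-- The affine coordinates of a point of a projective variety have transcendence degree at most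
its dimension. -/
theorem trd_affine_le (hX : IsProjVar X) {n : ℕ} (hn : adim X = (n + 1 : ℕ)) [Finite I]
    (j : parRing X I →ₐ[ℂ] K) (hj : Function.Injective j) (i : I) {b : δ}
    (hb : j (pt X i (LinearMap.proj b)) ≠ 0) :
    trd (Set.range fun d => j (sc X i * pt X i (LinearMap.proj d)) /
      j (sc X i * pt X i (LinearMap.proj b))) ≤ n := by
  obtain ⟨halg, hcone, hirr, -⟩ := hX
  obtain ⟨l, hl⟩ := exists_independent_functionals hirr hn
  have hind := algebraicIndependent_point j hj hl i
  have ht : j (sc X i) ≠ 0 := hind.ne_zero none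
  by_contra! hlt
  have hlt' : ((n + 1 : ℕ) : ℕ∞) ≤ trd (Set.range fun d => j (sc X i * pt X i (LinearMap.proj d)) /
      j (sc X i * pt X i (LinearMap.proj b))) := by
    rw [Nat.cast_add, Nat.cast_one]
    exact Order.add_one_le_of_lt hlt
  set A := Set.range fun d => j (sc X i * pt X i (LinearMap.proj d)) /
      j (sc X i * pt X i (LinearMap.proj b)) with hA
  set P := Set.range fun l => j (pt X i l) with hP
  set Q := Set.range fun l => j (sc X i * pt X i l) with hQ
  have hAQ : A ⊆ acl Q := by
    rintro _ ⟨d, rfl⟩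
    exact mem_aclField.1 (div_mem (mem_aclField.2 (subset_acl _ ⟨_, rfl⟩))
      (mem_aclField.2 (subset_acl _ ⟨_, rfl⟩)))
  have hAP : A ⊆ acl P := by
    rintro _ ⟨d, rfl⟩
    simp only [map_mul, mul_div_mul_left _ _ ht]
    exact mem_aclField.1 (div_mem (mem_aclField.2 (subset_acl _ ⟨_, rfl⟩))
      (mem_aclField.2 (subset_acl _ ⟨_, rfl⟩)))
  have hQn : trd Q ≤ (n + 1 : ℕ) := hn ▸ trd_sc_mul_pt_le halg hcone j hj i
  have hPn : trd P ≤ (n + 1 : ℕ) := hn ▸ trd_pt_le halg j hj i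
  have hfin : trd A ≠ ⊤ := ne_top_of_le_ne_top (ENat.natCast_ne_top _)
    ((trd_le_of_subset_acl hAQ).trans hQn)
  have heq : acl A = acl (A ∪ Q) := acl_eq_of_trd_le hfin Set.subset_union_left
    (((trd_le_of_subset_acl (Set.union_subset hAQ (subset_acl _))).trans hQn).trans hlt')
  have hb' : j (sc X i * pt X i (LinearMap.proj b)) ∈ acl P :=
    acl_subset_acl hAP (heq ▸ subset_acl _ (Or.inr ⟨_, rfl⟩))
  have hsc : j (sc X i) ∈ acl P := by
    have h1 := div_mem (mem_aclField.2 hb')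
      (mem_aclField.2 (subset_acl P ⟨LinearMap.proj b, rfl⟩))
    rw [map_mul, mul_div_cancel_right₀ _ hb] at h1
    exact mem_aclField.1 h1
  have hcard := (card_le_trd hind (S := P) (by
    rintro (_ | k)
    · exact hsc
    · exact subset_acl _ ⟨_, rfl⟩)).trans hPn
  rw [Fintype.card_option, Fintype.card_fin, Nat.cast_le] at hcard
  omega

theorem le_trd_param [Fintype J] [Fintype L] (hX : IsIrrAlg X) {N : ℕ} (hN : adim X = N)
    (j : parRing X ((J ⊕ L) ⊕ (J × L)) →ₐ[ℂ] K) (hj : Function.Injective j) :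
    ((N * (Fintype.card J + Fintype.card L) + Fintype.card J * Fintype.card L : ℕ) : ℕ∞) ≤
      trd ((Set.range fun z : (J ⊕ L) × δ => j (gpt X J L z.1 z.2)) ∪
        Set.range fun z : J × L => j (gco X J L z.1 z.2)) := by
  classical
  have := Fintype.ofFinite δ
  obtain ⟨l, hl⟩ := exists_independent_functionals hX hN
  have h := card_le_trd (algebraicIndependent_points j hj hl)
    (S := (Set.range fun z : (J ⊕ L) × δ => j (gpt X J L z.1 z.2)) ∪
        Set.range fun z : J × L => j (gco X J L z.1 z.2)) (by
    rintro (⟨s, k⟩ | z)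
    · have h1 : sc X (Sum.inl s) * pt X (Sum.inl s) (l k) =
          ∑ d, l k (Pi.single d 1) • gpt X J L s d := by
        rw [pt_eq_sum, Finset.mul_sum]
        exact Finset.sum_congr rfl fun d _ => mul_smul_comm _ _ _
      simp only [Sum.elim_inl, h1, map_sum, map_smul]
      refine mem_aclField.1 (sum_mem fun d _ => ?_)
      refine IntermediateField.smul_mem _ (mem_aclField.2 (subset_acl _ ?_))
      exact Or.inl ⟨(s, d), rfl⟩
    · exact subset_acl _ (Or.inr ⟨z, rfl⟩))
  refine le_trans (le_of_eq ?_) h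
  simp [mul_comm]

end generic

section secants
variable {W : Type*} [AddCommGroup W] [Module ℂ W] {X : Set W}

theorem exists_polyFun_of_sec_ne_univ {k : ℕ} (h : Sec X k ≠ Set.univ) :
    ∃ f ∈ PolyFun W, (∃ w, f w ≠ 0) ∧
      ∀ p : Fin (k + 1) → W, (∀ i, p i ∈ X) → ∀ w ∈ span ℂ (Set.range p), f w = 0 := by
  rw [Ne, Set.eq_univ_iff_forall, not_forall] at h
  obtain ⟨w, hw⟩ := h
  rw [Sec, mem_zcl_iff] at hw
  push Not at hw
  obtain ⟨f, hf, h0, hfw⟩ := hw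
  exact ⟨f, hf, ⟨w, hfw⟩, fun p hp x hx => h0 x (Set.mem_biUnion (x := p) hp hx)⟩

theorem exists_linearIndependent_of_sec_ne_univ [FiniteDimensional ℂ W] (hne : X.Nonempty)
    (hspan : span ℂ X = ⊤) {k : ℕ} (h : Sec X k ≠ Set.univ) {ι : Type*} [Fintype ι]
    (hι : Fintype.card ι = k + 2) :
    ∃ p : ι → W, (∀ i, p i ∈ X) ∧ LinearIndependent ℂ p := by
  obtain ⟨κ, a, ha, hsp, hli⟩ := exists_linearIndependent' ℂ (Subtype.val : X → W)
  rw [Subtype.range_coe, hspan] at hsp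
  have : Finite κ := hli.finite
  have := Fintype.ofFinite κ
  obtain ⟨f, -, ⟨w, hw⟩, hf⟩ := exists_polyFun_of_sec_ne_univ h
  have hcard : k + 2 ≤ Fintype.card κ := by
    by_contra! hlt
    obtain ⟨x, hx⟩ := hne
    have hemb : Nonempty (κ ↪ Fin (k + 1)) :=
      Function.Embedding.nonempty_of_card_le (by simp; omega)
    obtain ⟨g⟩ := hemb
    refine hw (hf (Function.extend g (fun i => (a i : W)) fun _ => x) (fun i => ?_) w ?_)
    · by_cases hi : ∃ i', g i' = i
      · obtain ⟨i', rfl⟩ := hi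
        rw [g.injective.extend_apply]
        exact (a i').2
      · rwa [Function.extend_apply' _ _ _ hi]
    · have h1 : w ∈ span ℂ (Set.range (Subtype.val ∘ a)) := hsp ▸ mem_top
      refine span_mono ?_ h1
      rintro _ ⟨i, rfl⟩
      exact ⟨g i, g.injective.extend_apply _ _ _⟩
  obtain ⟨g⟩ := Function.Embedding.nonempty_of_card_le (hι ▸ hcard)
  exact ⟨fun i => a (g i), fun i => (a (g i)).2, hli.comp g g.injective⟩

theorem exists_sum_of_span_eq_top (hc : IsCone X) (hspan : span ℂ X = ⊤) (w : W) :
    ∃ N, ∃ p : Fin N → W, (∀ i, p i ∈ X) ∧ ∑ i, p i = w := by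
  have hw : w ∈ span ℂ X := hspan ▸ mem_top
  induction hw using span_induction with
  | mem x hx => exact ⟨1, fun _ => x, fun _ => hx, by simp⟩
  | zero => exact ⟨0, fun _ => 0, fun _ => hc.1, by simp⟩
  | add x y _ _ hx hy =>
    obtain ⟨N, p, hp, rfl⟩ := hx
    obtain ⟨M, q, hq, rfl⟩ := hy
    refine ⟨N + M, Fin.append p q, fun i => ?_, by simp [Fin.sum_univ_add]⟩
    induction i using Fin.addCases with
    | left i => simpa using hp i
    | right i => simpa using hq i
  | smul c x _ hx =>
    obtain ⟨N, p, hp, rfl⟩ := hx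
    exact ⟨N, fun i => c • p i, fun i => hc.2 c _ (hp i), Finset.smul_sum.symm⟩

/-- Some polynomial function vanishes on all sums of `k + 1` points of `X` but not on all sums
of `k + 2` points. -/
theorem exists_polyFun_sum (hc : IsCone X) (hspan : span ℂ X = ⊤) {k : ℕ}
    (h : Sec X k ≠ Set.univ) :
    ∃ f ∈ PolyFun W, (∀ p : Fin (k + 1) → W, (∀ i, p i ∈ X) → f (∑ i, p i) = 0) ∧
      ∃ p : Fin (k + 2) → W, (∀ i, p i ∈ X) ∧ f (∑ i, p i) ≠ 0 := by
  obtain ⟨f, hf, ⟨w, hw⟩, hf0⟩ := exists_polyFun_of_sec_ne_univ h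
  by_contra! hcon
  have key : ∀ N, ∀ f ∈ PolyFun W,
      (∀ p : Fin (k + 1) → W, (∀ i, p i ∈ X) → f (∑ i, p i) = 0) →
      ∀ p : Fin N → W, (∀ i, p i ∈ X) → f (∑ i, p i) = 0 := by
    intro N
    induction N with
    | zero =>
      intro f hf hf0 p _
      simpa using hf0 (fun _ => 0) fun _ => hc.1
    | succ N ih =>
      intro f hf hf0 p hp
      rw [Fin.sum_univ_succ]
      refine ih (fun v => f (p 0 + v)) ?_ (fun q hq => ?_) _ fun i => hp i.succ
      · refine polyFun_comp_mem (PolyFun W) (fun v => p 0 + v) (fun l => ?_) hf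
        have : (fun v => l (p 0 + v)) = algebraMap ℂ (W → ℂ) (l (p 0)) + fun v => l v := by
          ext v
          simp
        rw [this]
        exact add_mem (Subalgebra.algebraMap_mem _ _) (linear_mem_polyFun l)
      · have h1 := hcon f hf hf0 (Fin.cons (p 0) q) fun i => by
          induction i using Fin.cases with
          | zero => exact hp 0
          | succ i => exact hq i
        simpa [Fin.sum_univ_succ] using h1
  obtain ⟨N, p, hp, rfl⟩ := exists_sum_of_span_eq_top hc hspan w
  exact hw (key N f hf (fun p hp => hf0 p hp _ (sum_mem fun i _ => subset_span ⟨i, rfl⟩)) p hp)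

end secants

section generic
variable {δ : Type*} [Fintype δ] {X : Set (δ → ℂ)} {K : Type*} [Field K] [Algebra ℂ K]

theorem gpt_linearIndependent {J L : Type*} [DecidableEq J] [DecidableEq L] [Fintype J]
    [Fintype L] (hne : X.Nonempty) (hspan : span ℂ X = ⊤) {k : ℕ} (h : Sec X k ≠ Set.univ)
    (hk : Fintype.card J + Fintype.card L = k + 2)
    (j : parRing X ((J ⊕ L) ⊕ (J × L)) →ₐ[ℂ] K) (hj : Function.Injective j) :
    LinearIndependent K fun s d => j (gpt X J L s d) := by
  obtain ⟨p, hp, hli⟩ := exists_linearIndependent_of_sec_ne_univ hne hspan h (ι := J ⊕ L)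
    (by simpa using hk)
  obtain ⟨c, hc⟩ := exists_minor_ne_zero hli
  obtain ⟨x, hx⟩ := hne
  refine linearIndependent_of_minor_ne_zero (c := c) ?_
  rw [← map_minor j]
  refine (map_ne_zero_iff j hj).2 fun h0 => hc ?_
  have h1 := congrArg (ev (Sum.elim (fun s => (⟨p s, hp s⟩, 1)) fun _ => (⟨x, hx⟩, 1))) h0
  rw [map_minor, map_zero] at h1
  simpa using h1

theorem exists_poly_rows {a m : ℕ} (hc : IsCone X) (hspan : span ℂ X = ⊤)
    (h : Sec X (a + m) ≠ Set.univ)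
    (j : parRing X ((Fin (a + 2) ⊕ Fin m) ⊕ (Fin (a + 2) × Fin m)) →ₐ[ℂ] K)
    (hj : Function.Injective j) :
    ∃ F : MvPolynomial δ ℂ,
      (∀ i, ∀ u : Fin (a + 2) → ℂ, u i = 0 → MvPolynomial.aeval (fun d => ∑ k, algebraMap ℂ K (u k) *
        rows (fun s d => j (gpt X _ _ s d)) (fun i l => j (gco X _ _ i l)) k d) F = 0) ∧
      MvPolynomial.aeval (fun d => ∑ k,
        rows (fun s d => j (gpt X _ _ s d)) (fun i l => j (gco X _ _ i l)) k d) F ≠ 0 := by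
  obtain ⟨f, hf, hf0, p, hp, hfp⟩ := exists_polyFun_sum hc hspan h
  obtain ⟨F, hF⟩ := polyOfBasis_surjective (Pi.basisFun ℂ δ) ⟨f, hf⟩
  have hF' : ∀ w, MvPolynomial.eval w F = f w := by
    intro w
    have h1 := congrFun (congrArg Subtype.val hF) w
    rw [polyOfBasis_apply] at h1
    simpa using h1
  have hev : ∀ u : Fin (a + 2) → ℂ, MvPolynomial.aeval (fun d => ∑ k, algebraMap ℂ K (u k) *
        rows (fun s d => j (gpt X _ _ s d)) (fun i l => j (gco X _ _ i l)) k d) F =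
      j (MvPolynomial.aeval (fun d => ∑ k, u k • rows (gpt X _ _) (gco X _ _) k d) F) := by
    intro u
    rw [MvPolynomial.comp_aeval_apply]
    congr 2
    ext d
    rw [map_sum]
    exact Finset.sum_congr rfl fun k _ => by rw [map_smul, map_rows, Algebra.smul_def]
  have hev' : ∀ (u : Fin (a + 2) → ℂ)
      (e : (Fin (a + 2) ⊕ Fin m) ⊕ (Fin (a + 2) × Fin m) → X × ℂ),
      ev e (MvPolynomial.aeval (fun d => ∑ k, u k • rows (gpt X _ _) (gco X _ _) k d) F) =
      f (∑ k, u k • ((e (Sum.inl (Sum.inl k))).2 • ((e (Sum.inl (Sum.inl k))).1 : δ → ℂ)) +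
        ∑ l, (∑ k, u k * (e (Sum.inr (k, l))).2) •
          ((e (Sum.inl (Sum.inr l))).2 • ((e (Sum.inl (Sum.inr l))).1 : δ → ℂ))) := by
    intro u e
    rw [MvPolynomial.comp_aeval_apply, ← hF', MvPolynomial.aeval_eq_eval]
    refine congrArg (fun w => MvPolynomial.eval w F) (funext fun d => ?_)
    have h1 (k : Fin (a + 2)) : ev e (u k • rows (gpt X _ _) (gco X _ _) k d) =
        u k * (ev e (gpt X _ _ (Sum.inl k) d) +
          ∑ l, ev e (gco X _ _ k l) * ev e (gpt X _ _ (Sum.inr l) d)) := by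
      rw [map_smul, map_rows, rows, smul_eq_mul]
    rw [map_sum]
    simp only [h1, ev_gpt, ev_gco, smul_eq_mul, mul_add,
      Finset.sum_add_distrib, Pi.add_apply, Finset.sum_apply, Pi.smul_apply, Finset.mul_sum,
      Finset.sum_mul, mul_assoc]
    rw [Finset.sum_comm (f := fun (x : Fin (a + 2)) (i : Fin m) => _)]
  refine ⟨F, fun i u hu => ?_, ?_⟩
  · rw [hev, map_eq_zero_iff j hj]
    refine parRing_ext fun e => ?_
    rw [hev', map_zero, Fin.sum_univ_succAbove _ i, hu, zero_smul, zero_add]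
    let z : Fin (a + 1) ⊕ Fin m → δ → ℂ := Sum.elim
      (fun k => u (i.succAbove k) • ((e (Sum.inl (Sum.inl (i.succAbove k)))).2 •
        ((e (Sum.inl (Sum.inl (i.succAbove k)))).1 : δ → ℂ)))
      (fun l => (∑ k, u k * (e (Sum.inr (k, l))).2) •
          ((e (Sum.inl (Sum.inr l))).2 • ((e (Sum.inl (Sum.inr l))).1 : δ → ℂ)))
    let g : Fin (a + m + 1) ≃ Fin (a + 1) ⊕ Fin m :=
      (finCongr (by omega)).trans finSumFinEquiv.symm
    have h1 := hf0 (fun k => z (g k)) fun k => by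
      rcases g k with k | k <;> exact hc.2 _ _ (hc.2 _ _ (e _).1.2)
    rw [Equiv.sum_comp g z] at h1
    simpa [z] using h1
  · have h1 := hev 1
    simp only [Pi.one_apply, map_one, one_mul] at h1
    rw [h1, Ne, map_eq_zero_iff j hj]
    intro h0
    let g : Fin (a + m + 2) ≃ Fin (a + 2) ⊕ Fin m :=
      (finCongr (by omega)).trans finSumFinEquiv.symm
    have h2 := hev' 1 (Sum.elim (fun s => (⟨p (g.symm s), hp _⟩, 1))
      fun z => (⟨0, hc.1⟩, if z.1 = 0 then 1 else 0))
    simp only [Pi.one_apply, h0, map_zero] at h2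
    refine hfp ?_
    rw [h2, ← Equiv.sum_comp g.symm]
    simp

end generic

section alternating
variable {δ : Type*} {W E : Type*} [AddCommGroup W] [Module ℂ W] [AddCommGroup E] [Module ℂ E]

theorem alternating_map_matrix {N : Type*} [Fintype N] [DecidableEq N] (g : W [⋀^N]→ₗ[ℂ] E)
    (A : Matrix N N ℂ) (v : N → W) : g (fun j => ∑ i, A j i • v i) = A.det • g v := by
  have h : g.compLinearMap (Fintype.linearCombination ℂ v) =
      (LinearMap.toSpanSingleton ℂ E (g v)).compAlternatingMap Matrix.detRowAlternating := by
    refine Module.Basis.ext_alternating (Pi.basisFun ℂ N) fun σ hσ => ?_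
    let τ : Equiv.Perm N := Equiv.ofBijective σ (Finite.injective_iff_bijective.1 hσ)
    have h1 : (g.compLinearMap (Fintype.linearCombination ℂ v)) (Pi.basisFun ℂ N) = g v := by
      simp [AlternatingMap.compLinearMap_apply, Fintype.linearCombination_apply_single]
    have h2 : Matrix.detRowAlternating (Pi.basisFun ℂ N) = (1 : ℂ) := by
      have h3 : (Pi.basisFun ℂ N : N → N → ℂ) = (1 : Matrix N N ℂ) := by
        ext i k
        simp [Matrix.one_apply, Pi.single_apply, eq_comm]
      rw [h3]
      exact Matrix.det_one
    change (g.compLinearMap _) (Pi.basisFun ℂ N ∘ τ) =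
      LinearMap.toSpanSingleton ℂ E (g v) (Matrix.detRowAlternating (Pi.basisFun ℂ N ∘ τ))
    rw [AlternatingMap.map_perm, AlternatingMap.map_perm, h1, h2]
    simp
  exact congrArg (fun f => f (Matrix.of.symm A)) h

theorem alternating_eq_sum_minor [Fintype δ] [DecidableEq δ] {N : Type*} [Fintype N]
    [DecidableEq N] (g : (δ → ℂ) [⋀^N]→ₗ[ℂ] ℂ) (q : N → δ → ℂ) :
    ((Fintype.card N).factorial : ℂ) * g q =
      ∑ c : N → δ, g (fun i => Pi.single (c i) 1) * minor q c := by
  have h1 : g q = ∑ c : N → δ, (∏ i, q i (c i)) * g (fun i => Pi.single (c i) 1) := by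
    have h2 : q = fun i => ∑ d, q i d • (Pi.single d 1 : δ → ℂ) := by
      ext i d
      simp [Finset.sum_apply, Pi.single_apply]
    conv_lhs => rw [h2]
    have h3 := g.toMultilinearMap.map_sum (fun i (d : δ) => q i d • (Pi.single d 1 : δ → ℂ))
    simp only [AlternatingMap.coe_multilinearMap] at h3
    rw [h3]
    refine Finset.sum_congr rfl fun c _ => ?_
    rw [← AlternatingMap.coe_multilinearMap, MultilinearMap.map_smul_univ, smul_eq_mul]
  have h2 (σ : Equiv.Perm N) : g q = ∑ c : N → δ, g (fun i => Pi.single (c i) 1) *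
      (Equiv.Perm.sign σ • ∏ i, q i (c (σ i))) := by
    rw [h1, ← Equiv.sum_comp (σ.symm.arrowCongr (Equiv.refl δ))]
    refine Finset.sum_congr rfl fun c _ => ?_
    have h3 := g.map_perm (fun i => Pi.single (c i) 1) σ
    have h4 : g (fun i => Pi.single (c (σ i)) 1) =
        Equiv.Perm.sign σ • g (fun i => Pi.single (c i) 1) := h3
    simp only [Equiv.arrowCongr_apply, Equiv.symm_symm, Equiv.coe_refl, Function.comp_apply, id]
    rw [h4, Units.smul_def, Units.smul_def, zsmul_eq_mul, zsmul_eq_mul]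
    ring
  have h3 : ((Fintype.card N).factorial : ℂ) * g q = ∑ _σ : Equiv.Perm N, g q := by
    rw [Finset.sum_const, Finset.card_univ, Fintype.card_perm, nsmul_eq_mul]
  rw [h3, Finset.sum_congr rfl fun σ _ => h2 σ, Finset.sum_comm]
  refine Finset.sum_congr rfl fun c _ => ?_
  rw [← Finset.mul_sum, minor, ← Matrix.det_transpose, Matrix.det_apply]
  rfl

theorem exists_functional_minor {N : ℕ} (c : Fin N → δ) :
    ∃ l : ExteriorAlgebra ℂ (δ → ℂ) →ₗ[ℂ] ℂ,
      ∀ q, l (ExteriorAlgebra.ιMulti ℂ N q) = minor q c := by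
  refine ⟨ExteriorAlgebra.liftAlternating (Pi.single N
    (Matrix.detRowAlternating.compLinearMap (LinearMap.funLeft ℂ ℂ c))), fun q => ?_⟩
  rw [ExteriorAlgebra.liftAlternating_apply_ιMulti, Pi.single_eq_same]
  rfl

end alternating

section wedge
variable {δ T : Type*} {R : Subalgebra ℂ (T → ℂ)} {N : ℕ}

/-- The family of wedge products of vectors whose coordinates are functions in `R`. -/
def wedge (q : Fin N → δ → R) (t : T) : ExteriorAlgebra ℂ (δ → ℂ) :=
  ExteriorAlgebra.ιMulti ℂ N fun i d => (q i d : T → ℂ) t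

theorem minor_coe_apply (q : Fin N → δ → R) (c : Fin N → δ) (t : T) :
    ((minor q c : R) : T → ℂ) t = minor (fun i d => (q i d : T → ℂ) t) c :=
  map_minor ((Pi.evalAlgHom ℂ (fun _ => ℂ) t).comp R.val) q c

variable [Fintype δ] [DecidableEq δ]

theorem linear_wedge (q : Fin N → δ → R) (l : ExteriorAlgebra ℂ (δ → ℂ) →ₗ[ℂ] ℂ) :
    (fun t => l (wedge q t)) = ((((N.factorial : ℂ)⁻¹) • ∑ c : Fin N → δ,
      l (ExteriorAlgebra.ιMulti ℂ N fun i => Pi.single (c i) 1) • minor q c : R) : T → ℂ) := by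
  funext t
  have h := alternating_eq_sum_minor (l.compAlternatingMap (ExteriorAlgebra.ιMulti ℂ N))
    (fun i d => (q i d : T → ℂ) t)
  have h0 : (N.factorial : ℂ) ≠ 0 := Nat.cast_ne_zero.2 (Nat.factorial_ne_zero _)
  simp only [Fintype.card_fin, LinearMap.compAlternatingMap_apply] at h
  rw [wedge, eq_inv_mul_iff_mul_eq₀ h0 |>.2 h]
  simp [Finset.sum_apply, minor_coe_apply]

theorem linear_wedge_mem (q : Fin N → δ → R) (l : ExteriorAlgebra ℂ (δ → ℂ) →ₗ[ℂ] ℂ) :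
    (fun t => l (wedge q t)) ∈ R := by
  rw [linear_wedge]
  exact SetLike.coe_mem _

end wedge

instance {δ : Type*} [Finite δ] : FiniteDimensional ℂ (ExteriorAlgebra ℂ (δ → ℂ)) := by
  have := Fintype.ofFinite δ
  let : LinearOrder δ := LinearOrder.lift' (Fintype.equivFin δ) (Fintype.equivFin δ).injective
  exact Module.Basis.finiteDimensional_of_finite (Pi.basisFun ℂ δ).ExteriorAlgebra

section wedge
variable {δ : Type*} [Fintype δ] [DecidableEq δ] {T : Type*} {R : Subalgebra ℂ (T → ℂ)}
  {K : Type*} [Field K] [Algebra ℂ K] {N : ℕ}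

theorem adim_zcl_range_wedge (j : R →ₐ[ℂ] K) (hj : Function.Injective j) (q : Fin N → δ → R) :
    adim (zcl (Set.range (wedge q))) = trd (Set.range (minor fun i d => j (q i d))) := by
  rw [adim_zcl_range R j hj (wedge q) (linear_wedge_mem q)]
  refine le_antisymm (trd_le_of_subset_acl ?_) (trd_mono ?_)
  · rintro _ ⟨l, rfl⟩
    have h1 : (⟨_, linear_wedge_mem q l⟩ : R) = _ := Subtype.ext (linear_wedge q l)
    change j (⟨fun t => l (wedge q t), linear_wedge_mem q l⟩ : R) ∈ acl _
    rw [h1, ← mem_aclField]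
    simp only [map_smul, map_sum, map_minor]
    exact IntermediateField.smul_mem _ (sum_mem fun c _ => IntermediateField.smul_mem _
      (mem_aclField.2 (subset_acl _ (Set.mem_range_self c))))
  · rintro _ ⟨c, rfl⟩
    obtain ⟨l, hl⟩ := exists_functional_minor c
    refine ⟨l, ?_⟩
    change j (⟨_, linear_wedge_mem q l⟩ : R) = minor (fun i d => j (q i d)) c
    rw [← map_minor j]
    refine congrArg j (Subtype.ext (funext fun t => ?_))
    rw [minor_coe_apply]
    exact hl _

end wedge

section normalForm
variable {δ : Type*} [Fintype δ] [DecidableEq δ]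

theorem polyFun_wedge_eq_zero {N : ℕ} {f : ExteriorAlgebra ℂ (δ → ℂ) → ℂ}
    (hf : f ∈ PolyFun (ExteriorAlgebra ℂ (δ → ℂ))) (x w : Fin N → δ → ℂ)
    (h : ∀ A : Matrix (Fin N) (Fin N) ℂ, A.det ≠ 0 →
      f (ExteriorAlgebra.ιMulti ℂ N fun j => ∑ i, A j i • x i + w j) = 0)
    (A : Matrix (Fin N) (Fin N) ℂ) :
    f (ExteriorAlgebra.ιMulti ℂ N fun j => ∑ i, A j i • x i + w j) = 0 := by
  let τ : lineRing := ⟨_, id_mem_lineRing⟩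
  let q (j : Fin N) (d : δ) : lineRing :=
    ∑ i, ((1 : Matrix (Fin N) (Fin N) ℂ) j i • τ + algebraMap ℂ lineRing (A j i)) *
      algebraMap ℂ lineRing (x i d) + algebraMap ℂ lineRing (w j d)
  have hq (t : ℂ) : wedge q t =
      ExteriorAlgebra.ιMulti ℂ N fun j => ∑ i, (t • (1 : Matrix (Fin N) (Fin N) ℂ) + A) j i • x i + w j := by
    refine congrArg _ (funext fun j => funext fun d => ?_)
    have h1 (i : Fin N) : (((1 : Matrix (Fin N) (Fin N) ℂ) j i • τ +
        algebraMap ℂ lineRing (A j i)) * algebraMap ℂ lineRing (x i d) : lineRing).1 t =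
        (t * (1 : Matrix (Fin N) (Fin N) ℂ) j i + A j i) * x i d := by
      rw [mul_comm t]
      rfl
    simp only [q, AddMemClass.coe_add,
      AddSubmonoidClass.coe_finsetSum, Pi.add_apply, Finset.sum_apply, h1, Matrix.add_apply,
      Matrix.smul_apply, smul_eq_mul, Pi.smul_apply]
    rfl
  have hF : (fun t => f (wedge q t)) ∈ lineRing := polyFun_comp_mem _ _ (linear_wedge_mem q) hf
  have hD : (fun t => (-A).charpoly.eval t) ∈ lineRing := ⟨_, fun _ => rfl⟩
  by_contra hne
  obtain ⟨t, ht, ht'⟩ := lineRing_isDom _ hF _ hD ⟨0, by rw [hq]; simpa using hne⟩ (by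
    by_contra! hall
    exact (-A).charpoly_monic.ne_zero (Polynomial.funext fun t => by simpa using hall t))
  refine ht ?_
  rw [hq]
  refine h _ ?_
  rw [Matrix.eval_charpoly, sub_neg_eq_add] at ht'
  rwa [Matrix.smul_one_eq_diagonal]

end normalForm

section normalForm
variable {δ J L : Type*} {X : Set (δ → ℂ)} [Fintype L]

/-- The point of the span of the parametrised points given by the row `i`. -/
def rowAt (e : (J ⊕ L) ⊕ (J × L) → X × ℂ) (i : J) : δ → ℂ :=
  (e (Sum.inl (Sum.inl i))).2 • ((e (Sum.inl (Sum.inl i))).1 : δ → ℂ) +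
    ∑ l, (e (Sum.inr (i, l))).2 •
      ((e (Sum.inl (Sum.inr l))).2 • ((e (Sum.inl (Sum.inr l))).1 : δ → ℂ))

theorem exists_rowAt (hc : IsCone X) {N : ℕ} {ρ : Fin N → J} (hρ : Function.Injective ρ)
    {x : Fin N → δ → ℂ} (hx : ∀ i, x i ∈ X) {y : L → δ → ℂ} (hy : ∀ l, y l ∈ X)
    (D : Fin N → L → ℂ) : ∃ e : (J ⊕ L) ⊕ (J × L) → X × ℂ,
      ∀ i, rowAt e (ρ i) = x i + ∑ l, D i l • y l := by
  refine ⟨Sum.elim (Sum.elim (Function.extend ρ (fun i => (⟨x i, hx i⟩, 1))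
    fun _ => (⟨0, hc.1⟩, 1)) fun l => (⟨y l, hy l⟩, 1)) fun z => (⟨0, hc.1⟩,
      Function.extend ρ (fun i => D i z.2) (fun _ => 0) z.1), fun i => ?_⟩
  simp [rowAt, hρ.extend_apply]

theorem rowAt_mem_span (hc : IsCone X) (e : (J ⊕ L) ⊕ (J × L) → X × ℂ) {N : ℕ} (ρ : Fin N → J) :
    ∃ p : Fin N ⊕ L → δ → ℂ, (∀ s, p s ∈ X) ∧
      ∀ i, rowAt e (ρ i) ∈ span ℂ (Set.range p) := by
  let p : Fin N ⊕ L → δ → ℂ := Sum.elim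
    (fun i => (e (Sum.inl (Sum.inl (ρ i)))).2 • ((e (Sum.inl (Sum.inl (ρ i)))).1 : δ → ℂ))
    (fun l => (e (Sum.inl (Sum.inr l))).2 • ((e (Sum.inl (Sum.inr l))).1 : δ → ℂ))
  refine ⟨p, ?_, fun i => add_mem (subset_span ⟨Sum.inl i, rfl⟩)
    (sum_mem fun l _ => smul_mem _ _ (subset_span ⟨Sum.inr l, rfl⟩))⟩
  rintro (i | l) <;> exact hc.2 _ _ (e _).1.2

variable [DecidableEq J] [DecidableEq L]

theorem ev_rows (e : (J ⊕ L) ⊕ (J × L) → X × ℂ) (i : J) (d : δ) :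
    ev e (rows (gpt X J L) (gco X J L) i d) = rowAt e i d := by
  rw [map_rows, rows]
  simp [rowAt, Finset.sum_apply]

theorem wedge_rows {N : ℕ} (ρ : Fin N → J) (e : (J ⊕ L) ⊕ (J × L) → X × ℂ) :
    wedge (fun i d => rows (gpt X J L) (gco X J L) (ρ i) d) e =
      ExteriorAlgebra.ιMulti ℂ N fun i => rowAt e (ρ i) :=
  congrArg _ (funext fun i => funext fun d => ev_rows e (ρ i) d)

variable [Fintype δ] [DecidableEq δ]

theorem zcl_range_wedge_rows (hc : IsCone X) {h k : ℕ} (hk : h + Fintype.card L = k)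
    {ρ : Fin (h + 1) → J} (hρ : Function.Injective ρ) :
    zcl (Set.range (wedge fun i d => rows (gpt X J L) (gco X J L) (ρ i) d)) =
      GhkCone X h k := by
  have g : Fin (k + 1) ≃ Fin (h + 1) ⊕ L := Fintype.equivOfCardEq (by simp; omega)
  refine zcl_eq_zcl fun f hf => ⟨fun H => ?_, fun H => ?_⟩
  · have h1 (x : Fin (h + 1) → δ → ℂ) (hx : ∀ i, x i ∈ X) (y : L → δ → ℂ) (hy : ∀ l, y l ∈ X)
        (D : Fin (h + 1) → L → ℂ) :
        f (ExteriorAlgebra.ιMulti ℂ (h + 1) fun i => x i + ∑ l, D i l • y l) = 0 := by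
      obtain ⟨e, he⟩ := exists_rowAt hc hρ hx hy D
      have h2 := H _ ⟨e, rfl⟩
      rw [wedge_rows] at h2
      simpa only [he] using h2
    rintro _ ⟨p, q, hp, hq, rfl⟩
    let x (i : Fin (h + 1)) := p (g.symm (Sum.inl i))
    let y (l : L) := p (g.symm (Sum.inr l))
    have h2 (i : Fin (h + 1)) : ∃ c : Fin (k + 1) → ℂ, ∑ s, c s • p s = q i :=
      (mem_span_range_iff_exists_fun ℂ).1 (hq i)
    choose c hcq using h2
    let C (i : Fin (h + 1)) (l : L) : ℂ := c i (g.symm (Sum.inr l))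
    have h3 := polyFun_wedge_eq_zero hf x (fun i => ∑ l, C i l • y l) (fun A hA => ?_)
      (Matrix.of fun j i => c j (g.symm (Sum.inl i)))
    · have h4 : q = fun i => ∑ i', Matrix.of (fun j i => c j (g.symm (Sum.inl i))) i i' • x i' +
          ∑ l, C i l • y l := by
        funext i
        rw [← hcq, ← Equiv.sum_comp g.symm, Fintype.sum_sum_type]
        rfl
      rw [h4]
      exact h3
    · have hA' : IsUnit A.det := isUnit_iff_ne_zero.2 hA
      let D (i : Fin (h + 1)) (l : L) : ℂ := ∑ i', A⁻¹ i i' * C i' l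
      have h4 : (fun j => ∑ i, A j i • x i + ∑ l, C j l • y l) =
          fun j => ∑ i, A j i • (x i + ∑ l, D i l • y l) := by
        funext j
        simp only [smul_add, Finset.sum_add_distrib]
        congr 1
        have h5 (l : L) : ∑ i, A j i * D i l = C j l := by
          have h6 : A * (A⁻¹ * Matrix.of C) = Matrix.of C := by
            rw [← Matrix.mul_assoc, Matrix.mul_nonsing_inv _ hA', Matrix.one_mul]
          exact congrFun (congrFun h6 j) l
        simp only [← h5, Finset.smul_sum, Finset.sum_smul, smul_smul]
        exact Finset.sum_comm
      rw [h4, alternating_map_matrix]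
      let a : Fin (h + 1) → ℂ := Fin.cons A.det 1
      have ha : ∏ i, a i = A.det := by simp [a, Fin.prod_univ_succ]
      have h7 := h1 (fun i => a i • x i) (fun i => hc.2 _ _ (hp _)) y (fun l => hp _)
        fun i l => a i * D i l
      simp only [mul_smul, ← Finset.smul_sum, ← smul_add] at h7
      rwa [← AlternatingMap.coe_multilinearMap, MultilinearMap.map_smul_univ, ha] at h7
  · rintro _ ⟨e, rfl⟩
    rw [wedge_rows]
    obtain ⟨p, hp, hspan⟩ := rowAt_mem_span hc e ρ
    refine H _ ⟨p ∘ g, fun i => rowAt e (ρ i), fun _ => hp _, fun i => ?_, rfl⟩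
    rw [g.surjective.range_comp]
    exact hspan i

end normalForm

section dimensions
variable {δ J L K : Type*} [Fintype L] {X : Set (δ → ℂ)}

theorem sec_mono (hX : IsCone X) {k l : ℕ} (h : k ≤ l) : Sec X k ⊆ Sec X l := by
  refine zcl_mono (Set.iUnion₂_subset fun p hp w hw => Set.mem_iUnion₂.2
    ⟨fun i => if hi : i.1 < k + 1 then p ⟨i, hi⟩ else 0, fun i => ?_, ?_⟩)
  · by_cases hi : i.1 < k + 1
    · simpa [hi] using hp _
    · simpa [hi] using hX.1
  · refine span_mono ?_ hw
    rintro _ ⟨i, rfl⟩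
    exact ⟨⟨i, by omega⟩, by simp [i.2]⟩

theorem sec_eq_zcl_range (hc : IsCone X) (i : J) :
    Sec X (Fintype.card L) =
      zcl (Set.range fun e : (J ⊕ L) ⊕ (J × L) → X × ℂ => rowAt e i) := by
  have g : Fin (Fintype.card L + 1) ≃ Fin 1 ⊕ L := Fintype.equivOfCardEq (by simp; omega)
  refine congrArg zcl (Set.Subset.antisymm (Set.iUnion₂_subset fun p hp w hw => ?_) ?_)
  · obtain ⟨c, rfl⟩ := (mem_span_range_iff_exists_fun ℂ).1 hw
    obtain ⟨e, he⟩ := exists_rowAt (ρ := fun _ : Fin 1 => i) hc (Function.injective_of_subsingleton _)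
      (x := fun i => c (g.symm (Sum.inl i)) • p (g.symm (Sum.inl i))) (fun _ => hc.2 _ _ (hp _))
      (y := fun l => p (g.symm (Sum.inr l))) (fun _ => hp _) fun _ l => c (g.symm (Sum.inr l))
    refine ⟨e, (he 0).trans ?_⟩
    rw [← Equiv.sum_comp g.symm, Fintype.sum_sum_type]
    simp
  · rintro _ ⟨e, rfl⟩
    obtain ⟨p, hp, hspan⟩ := rowAt_mem_span hc e fun _ : Fin 1 => i
    refine Set.mem_iUnion₂.2 ⟨p ∘ g, fun _ => hp _, ?_⟩
    rw [g.surjective.range_comp]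
    exact hspan 0

variable [Fintype δ] [DecidableEq δ] [DecidableEq J] [DecidableEq L] [Field K] [Algebra ℂ K]

theorem adim_GhkCone_eq_trd (hc : IsCone X) (j : parRing X ((J ⊕ L) ⊕ (J × L)) →ₐ[ℂ] K)
    (hj : Function.Injective j) {h k : ℕ} (hk : h + Fintype.card L = k) {ρ : Fin (h + 1) → J}
    (hρ : Function.Injective ρ) : adim (GhkCone X h k) = trd (Set.range (minor fun i =>
      rows (fun s d => j (gpt X J L s d)) (fun i l => j (gco X J L i l)) (ρ i))) := by
  rw [← zcl_range_wedge_rows (L := L) hc hk hρ, adim_zcl_range_wedge j hj]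
  simp only [map_rows]

theorem adim_sec_eq_trd (hc : IsCone X) (j : parRing X ((J ⊕ L) ⊕ (J × L)) →ₐ[ℂ] K)
    (hj : Function.Injective j) (i : J) : adim (Sec X (Fintype.card L)) = trd (Set.range
      (rows (fun s d => j (gpt X J L s d)) (fun i l => j (gco X J L i l)) i)) := by
  have h1 (l : (δ → ℂ) →ₗ[ℂ] ℂ) : (fun e : (J ⊕ L) ⊕ (J × L) → X × ℂ => l (rowAt e i)) =
      ((∑ d, l (Pi.single d 1) • rows (gpt X J L) (gco X J L) i d :
        parRing X ((J ⊕ L) ⊕ (J × L))) : _ → ℂ) := by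
    funext e
    rw [LinearMap.pi_apply_eq_sum_univ l]
    change _ = ev e _
    have h2 (d : δ) : (fun k => if d = k then (1 : ℂ) else 0) = Pi.single d 1 := by
      ext k
      simp [Pi.single_apply, eq_comm]
    simp only [map_sum, map_smul, ev_rows, smul_eq_mul, mul_comm (rowAt e i _), h2]
  have h2 (l : (δ → ℂ) →ₗ[ℂ] ℂ) : (fun e : (J ⊕ L) ⊕ (J × L) → X × ℂ => l (rowAt e i)) ∈
      parRing X ((J ⊕ L) ⊕ (J × L)) := by
    rw [h1]
    exact SetLike.coe_mem _
  have h3 (l : (δ → ℂ) →ₗ[ℂ] ℂ) : j ⟨_, h2 l⟩ = ∑ d, l (Pi.single d 1) •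
      rows (fun s d => j (gpt X J L s d)) (fun i l => j (gco X J L i l)) i d := by
    have h4 : (⟨_, h2 l⟩ : parRing X ((J ⊕ L) ⊕ (J × L))) = _ := Subtype.ext (h1 l)
    rw [h4]
    simp only [map_sum, map_smul, map_rows]
  rw [sec_eq_zcl_range (L := L) hc i, adim_zcl_range _ j hj _ h2]
  refine le_antisymm (trd_le_of_subset_acl ?_) (trd_mono ?_)
  · rintro _ ⟨l, rfl⟩
    change j (⟨fun e => l (rowAt e i), h2 l⟩ : parRing X ((J ⊕ L) ⊕ (J × L))) ∈ acl _
    rw [h3, ← mem_aclField]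
    exact sum_mem fun d _ => IntermediateField.smul_mem _
      (mem_aclField.2 (subset_acl _ (Set.mem_range_self d)))
  · rintro _ ⟨d, rfl⟩
    refine ⟨LinearMap.proj d, (h3 _).trans ?_⟩
    simp [Pi.single_apply]

end dimensions

theorem exists_algHom_injective.{u} {T : Type u} [Nonempty T] {R : Subalgebra ℂ (T → ℂ)} (hR : IsDom R) :
    ∃ (K : Type u) (_ : Field K) (_ : Algebra ℂ K) (j : R →ₐ[ℂ] K), Function.Injective j := by
  have := hR.isDomain
  exact ⟨FractionRing R, inferInstance, inferInstance, IsScalarTower.toAlgHom ℂ R _,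
    IsFractionRing.injective R (FractionRing R)⟩

section geometry
variable {δ : Type*} [Fintype δ] [DecidableEq δ] {X : Set (δ → ℂ)}

theorem adim_GhkCone_pred_lt {n a m : ℕ} (hX : IsProjVar X) (hnd : Nondeg X)
    (hn : adim X = (n + 1 : ℕ)) (hsec : Sec X (a + m) ≠ Set.univ)
    (hG : adim (GhkCone X (a + 1) (a + 1 + m)) < ((n * (a + 2 + m) + (a + 2) * m + 1 : ℕ) : ℕ∞)) :
    adim (GhkCone X a (a + m)) < ((n * (a + 1 + m) + (a + 1) * m + 1 : ℕ) : ℕ∞) := by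
  by_contra! hcon
  have hc := hX.2.1
  have hne : Nonempty X := ⟨⟨0, hc.1⟩⟩
  obtain ⟨K, _, _, j, hj⟩ := exists_algHom_injective
    (parRing_isDom (I := (Fin (a + 2) ⊕ Fin m) ⊕ (Fin (a + 2) × Fin m)) hX.2.2.1.irr)
  obtain ⟨p, hp, b, hpb⟩ : ∃ p ∈ X, ∃ b, p b ≠ 0 := by
    by_contra! hall
    exact hX.2.2.2 (Set.eq_singleton_iff_unique_mem.2 ⟨hc.1, fun p hp => funext (hall p hp)⟩)
  have hb (s : Fin (a + 2) ⊕ Fin m) : j (pt X (Sum.inl s) (LinearMap.proj b)) ≠ 0 := by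
    refine (map_ne_zero_iff j hj).2 fun h0 => hpb ?_
    simpa using congrArg (ev fun _ => (⟨p, hp⟩, 1)) h0
  have hb' (s : Fin (a + 2) ⊕ Fin m) : j (gpt X (Fin (a + 2)) (Fin m) s b) ≠ 0 := by
    refine (map_ne_zero_iff j hj).2 fun h0 => hpb ?_
    simpa using congrArg (ev fun _ => (⟨p, hp⟩, 1)) h0
  obtain ⟨F, hF0, hF1⟩ := exists_poly_rows hc hnd hsec j hj
  refine hG.not_ge ?_
  rw [adim_GhkCone_eq_trd (L := Fin m) hc j hj (by simp) Function.injective_id]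
  refine le_trd_minors hb' (gpt_linearIndependent ⟨0, hc.1⟩ hnd hsec (by simp; omega) j hj)
    (fun s => trd_affine_le hX hn j hj _ (hb s)) ?_ F hF0 hF1 fun i => ?_
  · have h1 := le_trd_param (J := Fin (a + 2)) (L := Fin m) hX.2.2.1 hn j hj
    simpa using h1
  · rw [← adim_GhkCone_eq_trd (L := Fin m) (h := a) (k := a + m) hc j hj (by simp)
      Fin.succAbove_right_injective]
    exact hcon

theorem adim_sec_eq_adim_GhkCone (hX : IsProjVar X) (m : ℕ) :
    adim (Sec X m) = adim (GhkCone X 0 m) := by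
  have hc := hX.2.1
  have hne : Nonempty X := ⟨⟨0, hc.1⟩⟩
  obtain ⟨K, _, _, j, hj⟩ := exists_algHom_injective
    (parRing_isDom (I := (Fin 1 ⊕ Fin m) ⊕ (Fin 1 × Fin m)) hX.2.2.1.irr)
  have h1 := adim_sec_eq_trd hc j hj 0
  rw [Fintype.card_fin] at h1
  rw [h1, adim_GhkCone_eq_trd (L := Fin m) (k := m) hc j hj (by simp) Function.injective_id]
  refine congrArg trd (Set.Subset.antisymm ?_ ?_)
  · rintro _ ⟨d, rfl⟩
    exact ⟨fun _ => d, by simp [minor]⟩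
  · rintro _ ⟨c, rfl⟩
    exact ⟨c 0, by simp [minor]⟩

theorem adim_sec_lt {n a m : ℕ} (hX : IsProjVar X) (hnd : Nondeg X)
    (hn : adim X = (n + 1 : ℕ)) (hsec : Sec X (a + m) ≠ Set.univ)
    (hG : adim (GhkCone X a (a + m)) < ((n * (a + 1 + m) + (a + 1) * m + 1 : ℕ) : ℕ∞)) :
    adim (Sec X m) < ((n * (m + 1) + m + 1 : ℕ) : ℕ∞) := by
  induction a with
  | zero =>
    rw [adim_sec_eq_adim_GhkCone hX]
    simpa [add_comm] using hG
  | succ a ih =>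
    have h1 : Sec X (a + m) ≠ Set.univ := fun h0 =>
      hsec (Set.univ_subset_iff.1 (h0 ▸ sec_mono hX.2.1 (by omega)))
    exact ih h1 (adim_GhkCone_pred_lt hX hnd hn h1 hG)

end geometry

section pdim
variable {W : Type*} [AddCommGroup W] [Module ℂ W] {X : Set W}

theorem pdim_lt_iff {M : ℕ} (hM : 0 < M) : pdim X < M ↔ adim X < (M + 1 : ℕ) := by
  rw [pdim]
  cases adim X with
  | top => simp
  | coe a =>
    norm_cast
    omega

theorem isIrrAlg_zero : IsIrrAlg ({0} : Set W) := by
  refine ⟨⟨0, rfl⟩, ⟨{f | IsLinearMap ℂ f}, Algebra.subset_adjoin, ?_⟩, fun Y Z _ _ h => ?_⟩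
  · ext x
    refine ⟨?_, fun h => ?_⟩
    · rintro rfl f hf
      exact hf.map_zero
    · exact (Module.forall_dual_apply_eq_zero_iff ℂ x).1 fun l => h l l.isLinear
  · simpa [Set.singleton_subset_iff] using h

theorem adim_eq_of_pdim_eq (hX : IsProjVar X) {n : ℕ} (h : pdim X = n) :
    adim X = (n + 1 : ℕ) := by
  have h1 : ((1 : ℕ) : ℕ∞) ≤ adim X := by
    have h0 : ({0} : Set W) ⊂ X :=
      (Set.singleton_subset_iff.2 hX.2.1.1).ssubset_of_ne hX.2.2.2.symm
    refine length_le_adim ![{0}, X] (Fin.strictMono_iff_lt_succ.2 fun i => ?_)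
      (Fin.forall_fin_two.2 ⟨⟨isIrrAlg_zero, h0.subset⟩, hX.2.2.1, subset_rfl⟩)
    rw [Subsingleton.elim i 0]
    exact h0
  rw [pdim] at h
  cases hX' : adim X with
  | top => simp [hX'] at h
  | coe a =>
    rw [hX'] at h h1
    norm_cast at h h1 ⊢
    omega

end pdim

/-- If `S_{k-1}(X) ≠ P^r` and `dim G_{h,k}(X) < (k-h)(h+1) + n(k+1)`, then
`dim G_{h-1,k-1}(X) < (k-h)h + nk`; in particular
`dim S_{k-h}(X) < n(k-h+1) + (k-h)`. -/
theorem dim_Ghk_pred_lt (r n h k : ℕ) (hh : 0 < h) (hhk : h < k)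
    (X : Set (Fin (r + 1) → ℂ)) (hX : IsProjVar X) (hnd : Nondeg X)
    (hdim : pdim X = (n : ℕ∞))
    (hsec : Sec X (k - 1) ≠ Set.univ)
    (hG : pdim (GhkCone X h k) < (((k - h) * (h + 1) + n * (k + 1) : ℕ) : ℕ∞)) :
    pdim (GhkCone X (h - 1) (k - 1)) < (((k - h) * h + n * k : ℕ) : ℕ∞) ∧
    pdim (Sec X (k - h)) < ((n * (k - h + 1) + (k - h) : ℕ) : ℕ∞) := by
  obtain ⟨a, rfl⟩ := Nat.exists_eq_add_one.2 hh
  obtain ⟨m, rfl⟩ := Nat.exists_eq_add_of_lt hhk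
  have hn := adim_eq_of_pdim_eq hX hdim
  have e1 : a + 1 + m + 1 - (a + 1) = m + 1 := by omega
  have e2 : a + 1 + m + 1 = a + 1 + (m + 1) := by omega
  have e3 : a + 1 + m + 1 - 1 = a + (m + 1) := by omega
  have e4 : a + 1 - 1 = a := by omega
  rw [e3] at hsec
  rw [e1, pdim_lt_iff (by positivity)] at hG
  rw [e1, e3, e4, pdim_lt_iff (by positivity), pdim_lt_iff (by positivity)]
  have h1 := adim_GhkCone_pred_lt hX hnd hn hsec (by
    rw [e2] at hG
    convert hG using 2
    ring)
  refine ⟨?_, adim_sec_lt hX hnd hn hsec h1⟩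
  convert h1 using 2
  ring
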